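/- arXiv:2401.15490 — 8 statements merged into one kernel-verified Lean document; each statement's English description precedes it below -/
import Mathlib

section
/- Let G be a finite simple graph containing 16 distinct vertices p₁, u₁, u₂, u₃, p₂, u₄, u₅, u₆, p₃, u₇, u₈, u₉, p₄, u₁₀, u₁₁, u₁₂ that form a cycle in this cyclic order (each consecutive pair is adjacent, and u₁₂ is adjacent to p₁), where each vertex uⱼ (1 ≤ j ≤ 12) has degree exactly 2 in G. If φ is a locally-balanced 2-partition of G with an open neighborhood, then φ(p₁) = φ(p₂) = φ(p₃) = φ(p₄). -/
/-- A 2-partition `φ : V → Fin 2` of a simple graph `G` is locally-balanced with an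
open neighborhood if for every vertex `v`, the numbers of neighbors of `v` in the two
classes differ by at most one. -/
def LocallyBalancedOpen {V : Type*} (G : SimpleGraph V) (φ : V → Fin 2) : Prop :=
  ∀ v : V,
    |(({u | G.Adj v u ∧ φ u = 0}.ncard : ℤ) - ({u | G.Adj v u ∧ φ u = 1}.ncard : ℤ))| ≤ 1

/-- The two neighbors of a vertex of degree two lie in different classes of a
locally-balanced 2-partition with an open neighborhood. -/
theorem LocallyBalancedOpen.apply_ne_of_ncard_neighborSet_eq_two {V : Type*}
    {G : SimpleGraph V} {φ : V → Fin 2} (hφ : LocallyBalancedOpen G φ) {v a b : V}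
    (ha : G.Adj v a) (hb : G.Adj v b) (hab : a ≠ b) (hv : (G.neighborSet v).ncard = 2) :
    φ a ≠ φ b := by
  intro h
  have hN : {a, b} = G.neighborSet v :=
    Set.eq_of_subset_of_ncard_le (Set.pair_subset ha hb) (by rw [hv, Set.ncard_pair hab])
      (Set.finite_of_ncard_ne_zero (by omega))
  have hclass : ∀ u, G.Adj v u → φ u = φ a := by
    intro u hu
    have hmem : u ∈ ({a, b} : Set V) := hN ▸ hu
    rcases hmem with rfl | rfl
    · rfl
    · exact h.symm
  have hsame : {u | G.Adj v u ∧ φ u = φ a} = G.neighborSet v :=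
    Set.ext fun u => ⟨And.left, fun hu => ⟨hu, hclass u hu⟩⟩
  have hother : ∀ c, c ≠ φ a → {u | G.Adj v u ∧ φ u = c} = ∅ := fun c hc =>
    Set.eq_empty_of_forall_notMem fun u hu => hc (hu.2.symm.trans (hclass u hu.1))
  have hbal := hφ v
  obtain h0 | h1 : φ a = 0 ∨ φ a = 1 := by omega
  · rw [h0] at hsame hother
    rw [hsame, hother 1 (by decide), hv] at hbal
    norm_num at hbal
  · rw [h1] at hsame hother
    rw [hsame, hother 0 (by decide), hv] at hbal
    norm_num at hbal

/-- `w 0, w 1, …, w 15` are the sixteen vertices of the cycle in cyclic order; the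
vertices `p₁, p₂, p₃, p₄` are `w 0, w 4, w 8, w 12` and the vertices `u₁, …, u₁₂` are
the `w i` with `i` not divisible by `4`. -/
theorem stmt_2 {V : Type*} [Fintype V] (G : SimpleGraph V)
    (w : Fin 16 → V) (hinj : Function.Injective w)
    (hcyc : ∀ i : Fin 16, G.Adj (w i) (w (i + 1)))
    (hdeg : ∀ i : Fin 16, ¬ (4 ∣ i.1) → (G.neighborSet (w i)).ncard = 2)
    (φ : V → Fin 2) (hφ : LocallyBalancedOpen G φ) :
    φ (w 0) = φ (w 4) ∧ φ (w 4) = φ (w 8) ∧ φ (w 8) = φ (w 12) := by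
  have halt : ∀ i : Fin 16, ¬ (4 ∣ (i + 1).1) → φ (w i) ≠ φ (w (i + 1 + 1)) := fun i hi =>
    hφ.apply_ne_of_ncard_neighborSet_eq_two (hcyc i).symm (hcyc (i + 1))
      (hinj.ne (by revert i; decide)) (hdeg _ hi)
  have h0 : φ (w 0) ≠ φ (w 2) := halt 0 (by decide)
  have h2 : φ (w 2) ≠ φ (w 4) := halt 2 (by decide)
  have h4 : φ (w 4) ≠ φ (w 6) := halt 4 (by decide)
  have h6 : φ (w 6) ≠ φ (w 8) := halt 6 (by decide)
  have h8 : φ (w 8) ≠ φ (w 10) := halt 8 (by decide)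
  have h10 : φ (w 10) ≠ φ (w 12) := halt 10 (by decide)
  omega
end

section
/- Let k ≥ 1 and let G be a (2, 2k+1)-biregular bipartite graph with bipartition (X, Y), where every vertex of X has degree 2 and every vertex of Y has degree 2k+1. Then G has a locally-balanced 2-partition with an open neighborhood if and only if G has no cycle whose length is congruent to 2 modulo 4. -/
open SimpleGraph

namespace SimpleGraph.Walk

theorem IsPath.length_eq_one_of_mk_mem_edges {V : Type*} {G : SimpleGraph V} {u v : V}
    {p : G.Walk u v} (hp : p.IsPath) (h : s(u, v) ∈ p.edges) : p.length = 1 := by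
  cases p with
  | nil => simp at h
  | cons hadj q =>
    rw [cons_isPath_iff] at hp
    rw [edges_cons, List.mem_cons] at h
    rcases h with h | h
    · have hv := Sym2.congr_right.mp h
      subst hv
      have := isPath_iff_nil.mp hp.1
      simp [length_eq_zero_iff.mpr this]
    · exact absurd (q.fst_mem_support_of_mem_edges h) hp.2

theorem even_length_bypass_iff {V : Type*} [DecidableEq V] {G : SimpleGraph V}
    (hG : ∀ (v : V) (c : G.Walk v v), c.IsCycle → Even c.length) {u v : V} (p : G.Walk u v) :
    Even p.bypass.length ↔ Even p.length := by
  induction p with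
  | nil => simp [bypass]
  | @cons u v w h p ih =>
    simp only [bypass]
    split_ifs with hs
    · have hlen := congrArg Walk.length (p.bypass.take_spec hs)
      rw [length_append] at hlen
      have hpath := p.bypass_isPath.takeUntil hs
      have hodd : Odd (p.bypass.takeUntil u hs).length := by
        by_cases he : s(u, v) ∈ (p.bypass.takeUntil u hs).edges
        · rw [hpath.length_eq_one_of_mk_mem_edges (by rwa [Sym2.eq_swap])]
          exact odd_one
        · have := hG _ _ ((cons_isCycle_iff _ h).mpr ⟨hpath, he⟩)
          rw [length_cons] at this
          grind
      rw [length_cons]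
      grind
    · rw [length_cons, length_cons, Nat.even_add_one, Nat.even_add_one, ih]

end SimpleGraph.Walk

theorem SimpleGraph.colorable_two_of_forall_isCycle_even {V : Type*} {G : SimpleGraph V}
    (hG : ∀ (v : V) (c : G.Walk v v), c.IsCycle → Even c.length) : G.Colorable 2 := by
  classical
  refine two_colorable_iff_forall_loop_even.mpr fun u w => ?_
  rw [← Walk.even_length_bypass_iff hG, Walk.length_eq_zero_iff.mpr
    (Walk.isPath_iff_nil.mp w.bypass_isPath)]
  exact Even.zero

/-- The graph on the vertices of `Y` in which distinct vertices are adjacent when they have a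
common neighbor in `G`. -/
def SimpleGraph.commonNeighborGraph {V : Type*} (G : SimpleGraph V) (Y : Set V) :
    SimpleGraph V where
  Adj u v := u ≠ v ∧ u ∈ Y ∧ v ∈ Y ∧ ∃ x, G.Adj u x ∧ G.Adj x v
  symm := ⟨fun _ _ ⟨hne, hu, hv, x, hx, hx'⟩ => ⟨hne.symm, hv, hu, x, hx'.symm, hx.symm⟩⟩
  loopless := ⟨fun _ h => h.1 rfl⟩

theorem SimpleGraph.neighborSet_eq_pair {V : Type*} {G : SimpleGraph V} {x a b : V}
    (hx : (G.neighborSet x).ncard = 2) (ha : G.Adj x a) (hb : G.Adj x b) (hab : a ≠ b) :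
    G.neighborSet x = {a, b} := by
  refine (Set.eq_of_subset_of_ncard_le ?_ ?_ (Set.finite_of_ncard_ne_zero (by omega))).symm
  · rintro z (rfl | rfl) <;> assumption
  · rw [hx, Set.ncard_pair hab]

theorem SimpleGraph.exists_isPath_of_commonNeighborGraph {V : Type*} {G : SimpleGraph V}
    {Y : Set V} (hbip : ∀ u v : V, G.Adj u v → (u ∉ Y ↔ v ∈ Y))
    (hdeg : ∀ x ∉ Y, (G.neighborSet x).ncard = 2) {u v : V}
    (p : (G.commonNeighborGraph Y).Walk u v) (hp : p.IsPath) (hv : v ∈ Y) :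
    ∃ q : G.Walk u v, q.IsPath ∧ q.length = 2 * p.length ∧
      (∀ w ∈ q.support, w ∈ Y → w ∈ p.support) ∧
      (∀ w ∈ q.support, w ∉ Y → ∃ a b, s(a, b) ∈ p.edges ∧ G.Adj w a ∧ G.Adj w b) := by
  induction p with
  | nil => exact ⟨.nil, by simpa using hv⟩
  | @cons u v w h p ih =>
    obtain ⟨q, hq, hlen, hY, hX⟩ := ih hp.of_cons hv
    obtain ⟨hne, hu, hvY, x, hux, hxv⟩ := id h
    have hup := ((Walk.cons_isPath_iff _ _).mp hp).2
    have hxY : x ∉ Y := fun hx => (hbip u x hux).mpr hx hu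
    have hxq : x ∉ q.support := fun hx => by
      obtain ⟨a, b, hab, hxa, hxb⟩ := hX x hx hxY
      have hmem : u ∈ ({a, b} : Set V) :=
        neighborSet_eq_pair (hdeg x hxY) hxa hxb (p.adj_of_mem_edges hab).1 ▸ hux.symm
      rcases hmem with rfl | rfl
      · exact hup (p.fst_mem_support_of_mem_edges hab)
      · exact hup (p.snd_mem_support_of_mem_edges hab)
    refine ⟨.cons hux (.cons hxv q), ?_, ?_, ?_, ?_⟩
    · rw [Walk.cons_isPath_iff, Walk.cons_isPath_iff, Walk.support_cons, List.mem_cons]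
      refine ⟨⟨hq, hxq⟩, ?_⟩
      rintro (rfl | huq)
      · exact hxY hu
      · exact hup (hY u huq hu)
    · simp only [Walk.length_cons, hlen]
      ring
    · simp only [Walk.support_cons, List.mem_cons]
      rintro z (rfl | rfl | hz) hzY
      · exact .inl rfl
      · exact absurd hzY hxY
      · exact .inr (hY z hz hzY)
    · simp only [Walk.support_cons, Walk.edges_cons, List.mem_cons]
      rintro z (rfl | rfl | hz) hzY
      · exact absurd hu hzY
      · exact ⟨u, v, .inl rfl, hux.symm, hxv⟩
      · obtain ⟨a, b, hab, h'⟩ := hX z hz hzY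
        exact ⟨a, b, .inr hab, h'⟩

theorem SimpleGraph.exists_isCycle_of_commonNeighborGraph {V : Type*} {G : SimpleGraph V}
    {Y : Set V} (hbip : ∀ u v : V, G.Adj u v → (u ∉ Y ↔ v ∈ Y))
    (hdeg : ∀ x ∉ Y, (G.neighborSet x).ncard = 2) {v : V}
    (c : (G.commonNeighborGraph Y).Walk v v) (hc : c.IsCycle) :
    ∃ d : G.Walk v v, d.IsCycle ∧ d.length = 2 * c.length := by
  cases c with
  | nil => exact absurd hc Walk.not_isCycle_nil
  | @cons _ v' _ h p =>
    obtain ⟨hp, he⟩ := (Walk.cons_isCycle_iff _ _).mp hc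
    obtain ⟨hne, hv, hvY, x, hvx, hxv⟩ := id h
    have hxY : x ∉ Y := fun hx => (hbip v x hvx).mpr hx hv
    obtain ⟨q, hq, hlen, -, hX⟩ := exists_isPath_of_commonNeighborGraph hbip hdeg p hp hv
    have hxq : x ∉ q.support := fun hx => by
      obtain ⟨a, b, hab, hxa, hxb⟩ := hX x hx hxY
      have hpair := (neighborSet_eq_pair (hdeg x hxY) hxa hxb (p.adj_of_mem_edges hab).1).symm.trans
        (neighborSet_eq_pair (hdeg x hxY) hvx.symm hxv hne)
      have : s(a, b) = s(v, v') := by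
        rw [Sym2.eq_iff]
        exact Set.pair_eq_pair_iff.mp hpair
      exact he (this ▸ hab)
    refine ⟨.cons hvx (.cons hxv q), ?_, ?_⟩
    · rw [Walk.cons_isCycle_iff, Walk.cons_isPath_iff, Walk.edges_cons, List.mem_cons]
      refine ⟨⟨hq, hxq⟩, ?_⟩
      rintro (h' | h')
      · rw [Sym2.eq_swap] at h'
        exact hne (Sym2.congr_right.mp h')
      · exact hxq (q.snd_mem_support_of_mem_edges h')
    · simp only [Walk.length_cons, hlen]
      ring

theorem Function.Involutive.exists_bool_ne {S : Type*} {a : S → S} (ha : a.Involutive)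
    (hfix : ∀ s, a s ≠ s) : ∃ φ : S → Bool, ∀ s, φ (a s) ≠ φ s := by
  classical
  let := linearOrderOfSTO (WellOrderingRel (α := S))
  refine ⟨fun s => decide (s < a s), fun s => ?_⟩
  simp only [ha s]
  rcases lt_or_gt_of_ne (hfix s) with h | h <;> simp [h, h.le]

theorem Function.Involutive.exists_bool_ne_of_pair {S : Type*} {a b : S → S}
    (ha : a.Involutive) (hb : b.Involutive) (hfa : ∀ s, a s ≠ s) (hfb : ∀ s, b s ≠ s) :
    ∃ φ : S → Bool, ∀ s, φ (a s) ≠ φ s ∧ φ (b s) ≠ φ s := by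
  let A : Equiv.Perm S := ha.toPerm
  let B : Equiv.Perm S := hb.toPerm
  have hA : A⁻¹ = A := rfl
  have hB : B⁻¹ = B := rfl
  have hAA : A * A = 1 := by rw [← mul_inv_cancel A, hA]
  have hBB : B * B = 1 := by rw [← mul_inv_cancel B, hB]
  let c := A * B
  have hinv : A * c * A⁻¹ = c⁻¹ := by
    simp only [c, mul_inv_rev, hA, hB]
    rw [← mul_assoc, hAA, one_mul]
  have hconj (n : ℤ) : A * c ^ n = c ^ (-n) * A := by
    have := conj_zpow (i := n) (a := A) (b := c)
    rwa [hinv, inv_zpow', eq_mul_inv_iff_mul_eq, eq_comm] at this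
  have happ (n : ℤ) (s : S) : a ((c ^ n) s) = (c ^ (-n)) (a s) :=
    congrArg (fun f : Equiv.Perm S => f s) (hconj n)
  let r := Equiv.Perm.SameCycle.setoid c
  have hr (s : S) : ¬ c.SameCycle s (a s) := by
    rintro ⟨n, hn⟩
    obtain ⟨m, rfl | rfl⟩ := Int.even_or_odd' n
    · apply hfa ((c ^ m) s)
      rw [happ, ← hn, ← Equiv.Perm.mul_apply, ← zpow_add]
      congr 2
      ring
    · apply hfb ((c ^ m) s)
      apply ha.injective
      change c ((c ^ m) s) = _
      rw [happ, ← hn, ← Equiv.Perm.mul_apply, ← Equiv.Perm.mul_apply, ← zpow_add, ← zpow_one_add]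
      congr 2
      ring
  let abar : Quotient r → Quotient r := Quotient.map a (by
    rintro s t ⟨n, hn⟩
    exact ⟨-n, by rw [← happ, hn]⟩)
  obtain ⟨φ, hφ⟩ := Function.Involutive.exists_bool_ne (a := abar)
    (by rintro ⟨s⟩; exact congrArg (Quotient.mk r) (ha s))
    (by
      rintro ⟨s⟩ h
      exact hr s (Quotient.exact h).symm)
  refine ⟨fun s => φ (Quotient.mk r s), fun s => ⟨hφ (Quotient.mk r s), ?_⟩⟩
  have : Quotient.mk r (b s) = Quotient.mk r (a s) :=
    Quotient.sound ⟨1, by rw [zpow_one]; exact congrArg a (hb s)⟩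
  simp only [this]
  exact hφ (Quotient.mk r s)

theorem Function.Involutive.exists_bool_ne_of_ne {S : Type*} {a b : S → S}
    (ha : a.Involutive) (hb : b.Involutive) :
    ∃ φ : S → Bool, ∀ s, (a s ≠ s → φ (a s) ≠ φ s) ∧ (b s ≠ s → φ (b s) ≠ φ s) := by
  classical
  let lift (f : S → S) (s : S × Bool) : S × Bool := (f s.1, if f s.1 = s.1 then !s.2 else s.2)
  have hlift {f : S → S} (hf : f.Involutive) : (lift f).Involutive := by
    rintro ⟨s, t⟩
    by_cases h : f s = s
    · simp [lift, h]
    · simp [lift, h, hf s, Ne.symm h]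
  have hfix (f : S → S) (s : S × Bool) : lift f s ≠ s := by
    obtain ⟨s, t⟩ := s
    by_cases h : f s = s <;> simp [lift, h]
  obtain ⟨φ, hφ⟩ := Function.Involutive.exists_bool_ne_of_pair (hlift ha) (hlift hb)
    (hfix a) (hfix b)
  refine ⟨fun s => φ (s, true), fun s => ⟨fun h => ?_, fun h => ?_⟩⟩
  · simpa [lift, h] using (hφ (s, true)).1
  · simpa [lift, h] using (hφ (s, true)).2

theorem exists_involutive_subsingleton_fixedPoints (S : Type*) [Finite S] :
    ∃ a : S → S, a.Involutive ∧ ∀ s t, a s = s → a t = t → s = t := by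
  let e := Finite.equivFin S
  refine ⟨fun s => e.symm (e s).rev, fun s => by simp, fun s t hs ht => ?_⟩
  rw [Equiv.symm_apply_eq] at hs ht
  apply e.injective
  rw [Fin.ext_iff, Fin.val_rev] at *
  omega

theorem exists_involutive_fiberwise {S T : Type*} [Finite S] (p : S → T) :
    ∃ a : S → S, a.Involutive ∧ (∀ s, p (a s) = p s) ∧
      ∀ s t, p s = p t → a s = s → a t = t → s = t := by
  choose τ hτ hfix using fun t : T => exists_involutive_subsingleton_fixedPoints {s // p s = t}
  have key (t : T) (s : S) (h : p s = t) : (τ (p s) ⟨s, rfl⟩ : S) = τ t ⟨s, h⟩ := by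
    subst h; rfl
  refine ⟨fun s => τ (p s) ⟨s, rfl⟩, fun s => ?_, fun s => (τ (p s) ⟨s, rfl⟩).2, ?_⟩
  · dsimp only
    rw [key (p s) _ (τ (p s) ⟨s, rfl⟩).2]
    simp only [Subtype.coe_eta, hτ (p s) ⟨s, rfl⟩]
  · intro s t hst hs ht
    simp only [key _ s hst] at hs
    exact congrArg Subtype.val (hfix (p t) ⟨s, hst⟩ ⟨t, rfl⟩ (Subtype.ext hs) (Subtype.ext ht))

theorem ncard_fiber_le_of_involutive {S T : Type*} [Finite S] {p : S → T} {a : S → S}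
    (ha : a.Involutive) (hp : ∀ s, p (a s) = p s)
    (hfix : ∀ s t, p s = p t → a s = s → a t = t → s = t) {φ : S → Bool}
    (hφ : ∀ s, a s ≠ s → φ (a s) ≠ φ s) (t : T) (i : Bool) :
    {s | p s = t ∧ φ s = i}.ncard ≤ {s | p s = t ∧ φ s = !i}.ncard + 1 := by
  have hsub : {s | p s = t ∧ φ s = i} ⊆
      a '' {s | p s = t ∧ φ s = !i} ∪ {s | p s = t ∧ a s = s} := by
    rintro s ⟨hs, hi⟩
    by_cases h : a s = s
    · exact .inr ⟨hs, h⟩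
    · refine .inl ⟨a s, ⟨(hp s).trans hs, ?_⟩, ha s⟩
      have := hφ s h
      rw [hi] at this
      exact Bool.eq_not_of_ne this
  calc _ ≤ _ := Set.ncard_le_ncard hsub
    _ ≤ _ := Set.ncard_union_le _ _
    _ ≤ _ := Nat.add_le_add Set.ncard_image_le ((Set.ncard_le_one (Set.toFinite _)).mpr 
      fun s hs s' hs' => hfix s s' (hs.1.trans hs'.1.symm) hs.2 hs'.2)

theorem exists_bool_balanced_fibers {S T : Type*} [Finite S] (p q : S → T) :
    ∃ φ : S → Bool, ∀ t i,
      {s | p s = t ∧ φ s = i}.ncard ≤ {s | p s = t ∧ φ s = !i}.ncard + 1 ∧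
      {s | q s = t ∧ φ s = i}.ncard ≤ {s | q s = t ∧ φ s = !i}.ncard + 1 := by
  obtain ⟨a, ha, hpa, hfa⟩ := exists_involutive_fiberwise p
  obtain ⟨b, hb, hqb, hfb⟩ := exists_involutive_fiberwise q
  obtain ⟨φ, hφ⟩ := ha.exists_bool_ne_of_ne hb
  exact ⟨φ, fun t i => ⟨ncard_fiber_le_of_involutive ha hpa hfa (fun s => (hφ s).1) t i,
    ncard_fiber_le_of_involutive hb hqb hfb (fun s => (hφ s).2) t i⟩⟩

section Balanced

variable {V : Type*} {G : SimpleGraph V} {Y : Set V}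

theorem LocallyBalancedOpen.ne_of_adj {φ : V → Fin 2} (hφ : LocallyBalancedOpen G φ) {x a b : V}
    (hx : (G.neighborSet x).ncard = 2) (ha : G.Adj x a) (hb : G.Adj x b) (hab : a ≠ b) :
    φ a ≠ φ b := by
  intro h
  have hset := neighborSet_eq_pair hx ha hb hab
  have hadj (u : V) : G.Adj x u → φ u = φ a := fun hu => by
    rcases (hset ▸ hu : u ∈ ({a, b} : Set V)) with rfl | rfl
    · rfl
    · exact h.symm
  have hsame : {u | G.Adj x u ∧ φ u = φ a} = G.neighborSet x := by
    ext u
    exact ⟨And.left, fun hu => ⟨hu, hadj u hu⟩⟩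
  have hother (i : Fin 2) (hi : i ≠ φ a) : {u | G.Adj x u ∧ φ u = i} = ∅ :=
    Set.eq_empty_of_forall_notMem fun u hu => hi (hu.2.symm.trans (hadj u hu.1))
  have hbal := hφ x
  obtain h0 | h1 : φ a = 0 ∨ φ a = 1 := by omega
  · rw [hother 1 (by simp [h0]), ← h0, hsame, hx] at hbal
    simp at hbal
  · rw [hother 0 (by simp [h1]), ← h1, hsame, hx] at hbal
    simp at hbal

theorem LocallyBalancedOpen.four_dvd_length (hbip : ∀ u v : V, G.Adj u v → (u ∉ Y ↔ v ∈ Y))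
    (hdeg : ∀ x ∉ Y, (G.neighborSet x).ncard = 2) {φ : V → Fin 2} (hφ : LocallyBalancedOpen G φ)
    {v : V} (hv : v ∈ Y) {c : G.Walk v v} (hc : c.IsCycle) : 4 ∣ c.length := by
  have h3 := hc.three_le_length
  have hY (i : ℕ) (hi : i ≤ c.length) : c.getVert i ∈ Y ↔ Even i := by
    induction i with
    | zero => simpa using hv
    | succ i ih =>
      rw [← hbip _ _ (c.adj_getVert_succ hi), ih (by omega), Nat.even_add_one]
  have heven : Even c.length := (hY _ le_rfl).mp (by simpa using hv)
  have hne (i : ℕ) (hi : i + 2 ≤ c.length) : c.getVert i ≠ c.getVert (i + 2) := by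
    intro h
    rcases Nat.eq_zero_or_pos i with rfl | hpos
    · replace h := (c.getVert_length.trans c.getVert_zero.symm).trans h
      have := hc.getVert_injOn ⟨by omega, le_rfl⟩ ⟨by omega, hi⟩ h
      omega
    · have := hc.getVert_injOn ⟨hpos, by omega⟩ ⟨by omega, hi⟩ h
      omega
  have hcol (j : ℕ) (hj : 2 * j ≤ c.length) : φ (c.getVert (2 * j)) = φ v ↔ Even j := by
    induction j with
    | zero => simp
    | succ j ih =>
      have hX : c.getVert (2 * j + 1) ∉ Y := by
        rw [hY _ (by omega)]
        simp
      have := hφ.ne_of_adj (hdeg _ hX) (c.adj_getVert_succ (i := 2 * j) (by omega)).symm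
        (c.adj_getVert_succ (i := 2 * j + 1) (by omega)) (hne _ (by omega))
      rw [Nat.even_add_one, ← ih (by omega)]
      change φ (c.getVert (2 * j + 1 + 1)) = _ ↔ _
      change _ ≠ φ (c.getVert (2 * j + 1 + 1)) at this
      omega
  obtain ⟨m, hm⟩ := heven.exists_two_nsmul
  rw [smul_eq_mul] at hm
  have := (hcol m hm.ge).mp (by rw [← hm, Walk.getVert_length])
  obtain ⟨n, hn⟩ := this
  exact ⟨n, by omega⟩

theorem exists_locallyBalancedOpen [Finite V] (hbip : ∀ u v : V, G.Adj u v → (u ∉ Y ↔ v ∈ Y))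
    (hdeg : ∀ x ∉ Y, (G.neighborSet x).ncard = 2)
    (C : (G.commonNeighborGraph Y).Coloring (Fin 2)) : ∃ φ, LocallyBalancedOpen G φ := by
  classical
  have hpair (x : {x // x ∉ Y}) : ∃ a b, G.neighborSet x = {a, b} ∧ C a = 0 ∧ C b = 1 := by
    obtain ⟨a, b, hab, hset⟩ := Set.ncard_eq_two.mp (hdeg x x.2)
    have ha : G.Adj x a := by
      rw [← mem_neighborSet, hset]
      simp
    have hb : G.Adj x b := by
      rw [← mem_neighborSet, hset]
      simp
    have hC : C a ≠ C b :=
      C.valid ⟨hab, (hbip _ _ ha).mp x.2, (hbip _ _ hb).mp x.2, x, ha.symm, hb⟩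
    obtain h | h : C a = 0 ∧ C b = 1 ∨ C b = 0 ∧ C a = 1 := by omega
    · exact ⟨a, b, hset, h⟩
    · exact ⟨b, a, hset.trans (Set.pair_comm a b), h⟩
  choose p q hpq hp hq using hpair
  obtain ⟨ψ, hψ⟩ := exists_bool_balanced_fibers p q
  let φ (v : V) : Fin 2 := if hv : v ∉ Y then (if ψ ⟨v, hv⟩ then 1 else 0) else C v
  refine ⟨φ, fun v => ?_⟩
  by_cases hv : v ∈ Y
  · have himage (r : {x // x ∉ Y} → V) (hr : ∀ x : {x // x ∉ Y}, G.Adj x v ↔ r x = v) (i : Bool) :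
        {u | G.Adj v u ∧ φ u = if i then 1 else 0}.ncard = {s | r s = v ∧ ψ s = i}.ncard := by
      rw [← Set.ncard_image_of_injective _ Subtype.val_injective]
      congr 1
      ext u
      constructor
      · rintro ⟨hu, hi⟩
        have huY : u ∉ Y := (hbip u v hu.symm).mpr hv
        refine ⟨⟨u, huY⟩, ⟨(hr _).mp hu.symm, ?_⟩, rfl⟩
        simp only [φ, dif_pos huY] at hi
        cases i <;> cases h : ψ ⟨u, huY⟩ <;> simp_all
      · rintro ⟨x, ⟨hx, hi⟩, rfl⟩
        exact ⟨((hr x).mpr hx).symm, by simp [φ, x.2, hi]⟩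
    have hadj (x : {x // x ∉ Y}) : G.Adj x v ↔ v = p x ∨ v = q x := by
      rw [← mem_neighborSet, hpq]
      rfl
    have hbal (r : {x // x ∉ Y} → V) (hr : ∀ x : {x // x ∉ Y}, G.Adj x v ↔ r x = v)
        (hle : ∀ i, {s | r s = v ∧ ψ s = i}.ncard ≤ {s | r s = v ∧ ψ s = !i}.ncard + 1) :
        |(({u | G.Adj v u ∧ φ u = 0}.ncard : ℤ) - ({u | G.Adj v u ∧ φ u = 1}.ncard : ℤ))| ≤ 1 := by
      have h0 := himage r hr false
      have h1 := himage r hr true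
      have hle0 := hle false
      have hle1 := hle true
      simp only [Bool.not_true, Bool.not_false, Bool.false_eq_true, if_true, if_false] at *
      rw [h0, h1, abs_le]
      omega
    obtain h | h : C v = 0 ∨ C v = 1 := by omega
    · refine hbal p (fun x => ?_) (fun i => (hψ v i).1)
      rw [hadj, eq_comm (a := p x), or_iff_left]
      rintro rfl
      simp [hq] at h
    · refine hbal q (fun x => ?_) (fun i => (hψ v i).2)
      rw [hadj, eq_comm (a := q x), or_iff_right]
      rintro rfl
      simp [hp] at h
  · have hsingle (r s : V) (i : Fin 2) (hset : G.neighborSet v = {r, s}) (hr : C r = i)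
        (hs : C s ≠ i) : {u | G.Adj v u ∧ φ u = i} = {r} := by
      have hφ (u : V) (hu : G.Adj v u) : φ u = C u := dif_neg (not_not.mpr ((hbip v u hu).mp hv))
      have hadj (u : V) : G.Adj v u ↔ u = r ∨ u = s := by
        rw [← mem_neighborSet, hset]
        rfl
      ext u
      constructor
      · rintro ⟨hu, hi⟩
        rw [hφ u hu] at hi
        exact ((hadj u).mp hu).resolve_right fun h => hs (h ▸ hi)
      · rintro rfl
        have hu := (hadj u).mpr (.inl rfl)
        exact ⟨hu, (hφ u hu).trans hr⟩
    rw [hsingle _ _ 0 (hpq ⟨v, hv⟩) (hp _) (by simp [hq]),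
      hsingle _ _ 1 ((hpq ⟨v, hv⟩).trans (Set.pair_comm _ _)) (hq _) (by simp [hp])]
    simp

end Balanced

theorem stmt_3 {V : Type*} [Fintype V] (G : SimpleGraph V) (k : ℕ) (hk : 1 ≤ k)
    (X Y : Set V)
    (hpart : ∀ v : V, v ∈ X ↔ v ∉ Y)
    (hbip : ∀ u v : V, G.Adj u v → (u ∈ X ↔ v ∈ Y))
    (hdegX : ∀ x ∈ X, (G.neighborSet x).ncard = 2)
    (hdegY : ∀ y ∈ Y, (G.neighborSet y).ncard = 2 * k + 1) :
    (∃ φ : V → Fin 2, LocallyBalancedOpen G φ) ↔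
      (∀ (v : V) (c : G.Walk v v), c.IsCycle → c.length % 4 ≠ 2) := by
  classical
  simp only [hpart] at hbip hdegX
  constructor
  · rintro ⟨φ, hφ⟩ v c hc
    obtain ⟨w, hw, hwY⟩ : ∃ w ∈ c.support, w ∈ Y := by
      by_cases hv : v ∈ Y
      · exact ⟨v, c.start_mem_support, hv⟩
      · exact ⟨c.snd, c.getVert_mem_support 1, (hbip _ _ (c.adj_snd hc.not_nil)).mp hv⟩
    have := hφ.four_dvd_length hbip hdegX hwY (hc.rotate hw)
    rw [Walk.length_rotate] at this
    omega
  · intro h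
    obtain ⟨C⟩ := colorable_two_of_forall_isCycle_even (G := G.commonNeighborGraph Y)
      fun v c hc => by
        obtain ⟨d, hd, hlen⟩ := exists_isCycle_of_commonNeighborGraph hbip hdegX c hc
        have := h v d hd
        rw [Nat.even_iff]
        omega
    exact exists_locallyBalancedOpen hbip hdegX C
end

section
/- Let G be a finite simple graph containing a cycle x₁, y₁, x₂, y₂, …, x_m, y_m, x₁ of length 2m in which each vertex xᵢ (1 ≤ i ≤ m) has degree exactly 2 in G. If m is odd (i.e., the cycle has length congruent to 2 modulo 4), then G admits no locally-balanced 2-partition with an open neighborhood. -/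
/-- In a locally-balanced 2-partition, the two neighbors of a vertex of degree two lie in
different classes. -/
theorem LocallyBalancedOpen.ne_of_neighborSet_eq_pair {V : Type*} {G : SimpleGraph V}
    {φ : V → Fin 2} (h : LocallyBalancedOpen G φ) {v a b : V} (hab : a ≠ b)
    (hv : G.neighborSet v = {a, b}) : φ a ≠ φ b := by
  intro hφ
  have hadj : ∀ u, G.Adj v u ↔ u = a ∨ u = b := fun u => by
    rw [← SimpleGraph.mem_neighborSet, hv]; rfl
  have hsame : {u | G.Adj v u ∧ φ u = φ a} = {a, b} := by
    ext u
    simp only [hadj, Set.mem_ofPred_eq, Set.mem_insert_iff, Set.mem_singleton_iff]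
    grind
  have hother : ∀ c, c ≠ φ a → {u | G.Adj v u ∧ φ u = c} = ∅ := by
    intro c hc
    ext u
    simp only [hadj, Set.mem_ofPred_eq, Set.mem_empty_iff_false]
    grind
  have hbal := h v
  obtain hc | hc : φ a = 0 ∨ φ a = 1 := by omega
  · rw [hc] at hsame
    rw [hsame, hother 1 (by simp [hc]), Set.ncard_pair hab] at hbal
    simp at hbal
  · rw [hc] at hsame
    rw [hsame, hother 0 (by simp [hc]), Set.ncard_pair hab] at hbal
    simp at hbal

/-- A function on an odd cyclic group with values in a two-element type takes equal values
at some two consecutive elements. -/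
theorem exists_apply_add_one_eq_of_odd (s : ℕ) (c : Fin (2 * s + 1) → Fin 2) :
    ∃ i, c (i + 1) = c i := by
  by_contra! hne
  have hstep : ∀ i, c (i + 1) = c i + 1 := fun i => by
    have := hne i
    omega
  have hsum : ∑ i, c (i + 1) = ∑ i, c i := Equiv.sum_comp (Equiv.addRight 1) c
  simp only [hstep, Finset.sum_add_distrib, add_eq_left, Finset.sum_const, Finset.card_univ,
    Fintype.card_fin] at hsum
  rw [add_nsmul, mul_nsmul, show 2 • (1 : Fin 2) = 0 from rfl, nsmul_zero, one_nsmul] at hsum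
  simp at hsum

/-- Here `m = 2 * s + 1` is odd (so the cycle length `2 * m ≡ 2 (mod 4)`), the cycle is
`x 0, y 0, x 1, y 1, …, x (m-1), y (m-1), x 0`, its `2 * m` vertices are pairwise
distinct, and every `x i` has degree exactly `2` in `G`. -/
theorem stmt_4 {V : Type*} [Fintype V] (G : SimpleGraph V) (s : ℕ) (hs : 1 ≤ s)
    (x y : Fin (2 * s + 1) → V)
    (hinj : Function.Injective (Sum.elim x y : Fin (2 * s + 1) ⊕ Fin (2 * s + 1) → V))
    (hxy : ∀ i, G.Adj (x i) (y i))
    (hyx : ∀ i, G.Adj (y i) (x (i + 1)))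
    (hdeg : ∀ i, (G.neighborSet (x i)).ncard = 2) :
    ¬ ∃ φ : V → Fin 2, LocallyBalancedOpen G φ := by
  rintro ⟨φ, hφ⟩
  obtain ⟨i, hi⟩ := exists_apply_add_one_eq_of_odd s (φ ∘ y)
  have hy : y i ≠ y (i + 1) := by
    intro h
    have hsucc : i = i + 1 := Sum.inr_injective (hinj (a₁ := .inr i) (a₂ := .inr (i + 1)) h)
    have hone := congrArg Fin.val (left_eq_add.mp hsucc)
    rw [Fin.val_one', Nat.mod_eq_of_lt (by omega)] at hone
    simp at hone
  have hsub : {y i, y (i + 1)} ⊆ G.neighborSet (x (i + 1)) := by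
    rintro u (rfl | rfl)
    · exact (hyx i).symm
    · exact hxy (i + 1)
  have hset := Set.eq_of_subset_of_ncard_le hsub
    (by rw [hdeg, Set.ncard_pair hy]) (Set.toFinite _)
  exact hφ.ne_of_neighborSet_eq_pair hy hset.symm hi.symm
end

section
/- Let k ≥ 1 and let G be a (2, 2k+1)-biregular bipartite graph with bipartition (X, Y), where every vertex of X has degree 2 and every vertex of Y has degree 2k+1. If G has no cycle whose length is congruent to 2 modulo 4, then G has a locally-balanced 2-partition with an open neighborhood. -/
open Finset

namespace SimpleGraph

variable {V : Type*}

lemma Walk.even_length_iff_even_length_bypass [DecidableEq V] {G : SimpleGraph V}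
    (hG : ∀ (v : V) (c : G.Walk v v), c.IsCycle → Even c.length) {u v : V} (p : G.Walk u v) :
    Even p.length ↔ Even p.bypass.length := by
  induction p with
  | nil => simp [Walk.bypass]
  | @cons u w v h p ih =>
    rw [Walk.bypass]
    split_ifs with hs
    · have htake : Even (p.bypass.takeUntil u hs).length ↔ False := by
        have hpath := p.bypass_isPath.takeUntil hs
        by_cases he : s(u, w) ∈ (p.bypass.takeUntil u hs).edges
        · rw [Sym2.eq_swap] at he
          simp [hpath.length_eq_one_of_mem_edges he]
        · have := hG _ _ ((Walk.cons_isCycle_iff _ h).2 ⟨hpath, he⟩)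
          simpa [Nat.even_add_one] using this
      have hlen := congrArg Walk.length (p.bypass.take_spec hs)
      rw [Walk.length_append] at hlen
      rw [Walk.length_cons, Nat.even_add_one, ih, ← hlen, Nat.even_add, htake]
      tauto
    · simp only [Walk.length_cons, Nat.even_add_one, ih]

lemma two_colorable_of_even_cycles {G : SimpleGraph V}
    (hG : ∀ (v : V) (c : G.Walk v v), c.IsCycle → Even c.length) : G.Colorable 2 := by
  classical
  refine two_colorable_iff_forall_loop_even.2 fun u w ↦ ?_
  rw [w.even_length_iff_even_length_bypass hG, (Walk.isPath_iff_nil.mp w.bypass_isPath).length_eq_zero]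
  simp

/-- The graph on `Y` joining two distinct vertices that have a common neighbor in `G`. -/
def commonNeighborGraph_s5 (G : SimpleGraph V) (Y : Set V) : SimpleGraph V where
  Adj u v := u ≠ v ∧ u ∈ Y ∧ v ∈ Y ∧ ∃ x, G.Adj x u ∧ G.Adj x v
  symm := ⟨fun _ _ ⟨h, hu, hv, x, hxu, hxv⟩ ↦ ⟨h.symm, hv, hu, x, hxv, hxu⟩⟩
  loopless := ⟨fun _ h ↦ h.1 rfl⟩

section Lift

variable {G : SimpleGraph V} {X Y : Set V}

lemma sym2_eq_of_ncard_neighborSet_eq_two {x a b c d : V}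
    (hx : (G.neighborSet x).ncard = 2) (hab : a ≠ b) (hcd : c ≠ d)
    (ha : G.Adj x a) (hb : G.Adj x b) (hc : G.Adj x c) (hd : G.Adj x d) :
    s(a, b) = s(c, d) := by
  obtain ⟨y, z, -, hyz⟩ := Set.ncard_eq_two.mp hx
  have key : ∀ w, G.Adj x w → w = y ∨ w = z := fun w hw ↦ by
    have : w ∈ G.neighborSet x := hw
    simpa [hyz] using this
  rw [Sym2.eq_iff]
  grind

lemma exists_subdivided_path (hpart : ∀ v : V, v ∈ X ↔ v ∉ Y)
    (hbip : ∀ u v : V, G.Adj u v → (u ∈ X ↔ v ∈ Y))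
    (hdegX : ∀ x ∈ X, (G.neighborSet x).ncard = 2) {u v : V}
    (p : (G.commonNeighborGraph_s5 Y).Walk u v) (hp : p.IsPath) (hu : u ∈ Y) :
    ∃ q : G.Walk u v, q.IsPath ∧ q.length = 2 * p.length ∧
      (∀ y ∈ Y, y ∈ q.support → y ∈ p.support) ∧
      ∀ x ∈ X, x ∈ q.support → ∀ a b, a ≠ b → G.Adj x a → G.Adj x b → s(a, b) ∈ p.edges := by
  induction p with
  | nil =>
    refine ⟨.nil, by simp, by simp, by simp, ?_⟩
    intro x hx hxu
    obtain rfl : x = _ := by simpa using hxu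
    exact absurd hu ((hpart _).1 hx)
  | @cons u w v h p ih =>
    rw [Walk.cons_isPath_iff] at hp
    obtain ⟨huw, -, hw, x, hxu, hxw⟩ := id h
    obtain ⟨q, hq, hlen, hY, hX⟩ := ih hp.1 hw
    have hx : x ∈ X := (hbip _ _ hxu).2 hu
    have hxq : x ∉ q.support := fun hmem ↦
      hp.2 (p.fst_mem_support_of_mem_edges (hX x hx hmem u w huw hxu hxw))
    have huq : u ∉ q.support := fun hmem ↦ hp.2 (hY u hu hmem)
    refine ⟨.cons hxu.symm (.cons hxw q), ?_, ?_, ?_, ?_⟩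
    · simp [Walk.cons_isPath_iff, hq, hxq, huq, hxu.ne']
    · simp [hlen]; ring
    · intro y hy hmem
      simp only [Walk.support_cons, List.mem_cons] at hmem ⊢
      rcases hmem with rfl | rfl | hmem
      · exact .inl rfl
      · exact absurd hy ((hpart _).1 hx)
      · exact .inr (hY y hy hmem)
    · intro z hz hmem a b hab ha hb
      simp only [Walk.support_cons, Walk.edges_cons, List.mem_cons] at hmem ⊢
      rcases hmem with rfl | rfl | hmem
      · exact absurd hu ((hpart _).1 hz)
      · exact .inl (sym2_eq_of_ncard_neighborSet_eq_two (hdegX _ hz) hab huw ha hb hxu hxw)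
      · exact .inr (hX z hz hmem a b hab ha hb)

lemma exists_subdivided_cycle (hpart : ∀ v : V, v ∈ X ↔ v ∉ Y)
    (hbip : ∀ u v : V, G.Adj u v → (u ∈ X ↔ v ∈ Y))
    (hdegX : ∀ x ∈ X, (G.neighborSet x).ncard = 2) {u : V}
    (c : (G.commonNeighborGraph_s5 Y).Walk u u) (hc : c.IsCycle) :
    ∃ q : G.Walk u u, q.IsCycle ∧ q.length = 2 * c.length := by
  cases c with
  | nil => simp at hc
  | @cons _ w _ h p =>
    rw [Walk.cons_isCycle_iff] at hc
    obtain ⟨huw, hu, hw, x, hxu, hxw⟩ := id h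
    obtain ⟨q, hq, hlen, -, hX⟩ := exists_subdivided_path hpart hbip hdegX p hc.1 hw
    have hx : x ∈ X := (hbip _ _ hxu).2 hu
    have hxq : x ∉ q.support := fun hmem ↦ hc.2 (hX x hx hmem u w huw hxu hxw)
    refine ⟨.cons hxu.symm (.cons hxw q), ?_, by simp [hlen]; ring⟩
    rw [Walk.cons_isCycle_iff, Walk.cons_isPath_iff, Walk.edges_cons, List.mem_cons]
    refine ⟨⟨hq, hxq⟩, ?_⟩
    rintro (he | he)
    · rcases Sym2.eq_iff.1 he with ⟨h, -⟩ | ⟨h, -⟩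
      · exact hxu.ne h.symm
      · exact huw h
    · exact hxq (q.snd_mem_support_of_mem_edges he)

end Lift

end SimpleGraph

section Factor

variable {ι α β : Type*} [DecidableEq ι] [DecidableEq α] [DecidableEq β]

/-- A regular bipartite multigraph, with edge set `E` and endpoint maps `a` and `b`, has a perfect
matching. -/
lemma exists_perfect_matching_of_card_fiber_eq {a : ι → α} {b : ι → β} {A : Finset α}
    {B : Finset β} {E : Finset ι} {d : ℕ} (hd : 0 < d)
    (ha : ∀ x ∈ E, a x ∈ A) (hb : ∀ x ∈ E, b x ∈ B)
    (hA : ∀ y ∈ A, #{x ∈ E | a x = y} = d) (hB : ∀ z ∈ B, #{x ∈ E | b x = z} = d) :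
    ∃ M ⊆ E, (∀ y ∈ A, #{x ∈ M | a x = y} = 1) ∧ ∀ z ∈ B, #{x ∈ M | b x = z} = 1 := by
  let t : A → Finset β := fun y ↦ {x ∈ E | a x = y}.image b
  have hall : ∀ S : Finset A, #S ≤ #(S.biUnion t) := by
    intro S
    have hS : #{x ∈ E | a x ∈ S.map (.subtype _)} = #S * d := by
      rw [card_eq_sum_card_fiberwise (s := {x ∈ E | a x ∈ S.map (.subtype _)}) (f := a)
        (t := S.map (.subtype _))
        (fun x hx ↦ (mem_filter.1 hx).2), sum_congr rfl (g := fun _ ↦ d), sum_const, card_map,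
        smul_eq_mul]
      intro y hy
      rw [filter_filter, ← hA y (by aesop)]
      congr 1
      ext x
      simp only [mem_filter]
      constructor
      · tauto
      · rintro ⟨h1, rfl⟩
        exact ⟨h1, hy, rfl⟩
    have hN : #{x ∈ E | b x ∈ S.biUnion t} ≤ #(S.biUnion t) * d := by
      rw [card_eq_sum_card_fiberwise (s := {x ∈ E | b x ∈ S.biUnion t}) (f := b) (t := S.biUnion t)
        (fun x hx ↦ (mem_filter.1 hx).2), ← smul_eq_mul]
      refine sum_le_card_nsmul _ _ _ fun z hz ↦ ?_
      have hzB : z ∈ B := by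
        simp only [t, mem_biUnion, mem_image, mem_filter] at hz
        obtain ⟨-, -, x, ⟨hx, -⟩, rfl⟩ := hz
        exact hb x hx
      rw [← hB z hzB]
      exact card_le_card (filter_subset_filter _ (filter_subset _ _))
    refine Nat.le_of_mul_le_mul_right ((hS.ge.trans (card_le_card ?_)).trans hN) hd
    intro x hx
    simp only [mem_filter, mem_map, Function.Embedding.subtype_apply] at hx ⊢
    obtain ⟨hxE, y, hy, hyx⟩ := hx
    exact ⟨hxE, mem_biUnion.2 ⟨y, hy, mem_image.2 ⟨x, mem_filter.2 ⟨hxE, hyx.symm⟩, rfl⟩⟩⟩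
  obtain ⟨f, hf, hft⟩ := (Finset.all_card_le_biUnion_card_iff_exists_injective t).1 hall
  simp only [t, mem_image, mem_filter] at hft
  choose e he hbe using hft
  have hcard : #A = #B := by
    have h1 : #E = #A * d := by
      rw [card_eq_sum_card_fiberwise (f := a) (t := A) ha, sum_congr rfl hA, sum_const,
        smul_eq_mul]
    have h2 : #E = #B * d := by
      rw [card_eq_sum_card_fiberwise (f := b) (t := B) hb, sum_congr rfl hB, sum_const,
        smul_eq_mul]
    exact Nat.eq_of_mul_eq_mul_right hd (h1.symm.trans h2)
  have hfB : univ.image f = B := by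
    refine eq_of_subset_of_card_le ?_ ?_
    · intro z hz
      obtain ⟨y, -, rfl⟩ := mem_image.1 hz
      exact hbe y ▸ hb _ (he y).1
    · rw [card_image_of_injective _ hf, card_univ, Fintype.card_coe, hcard]
  refine ⟨univ.image e, ?_, ?_, ?_⟩
  · intro x hx
    obtain ⟨y, -, rfl⟩ := mem_image.1 hx
    exact (he y).1
  · intro y hy
    refine card_eq_one.2 ⟨e ⟨y, hy⟩, ?_⟩
    ext x
    simp only [mem_filter, mem_image, mem_univ, true_and, mem_singleton]
    constructor
    · rintro ⟨⟨y', rfl⟩, rfl⟩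
      congr 1
      exact Subtype.ext (he y').2.symm
    · rintro rfl
      exact ⟨⟨_, rfl⟩, (he _).2⟩
  · intro z hz
    rw [← hfB] at hz
    obtain ⟨y, -, rfl⟩ := mem_image.1 hz
    refine card_eq_one.2 ⟨e y, ?_⟩
    ext x
    simp only [mem_filter, mem_image, mem_univ, true_and, mem_singleton]
    constructor
    · rintro ⟨⟨y', rfl⟩, h⟩
      rw [hbe] at h
      rw [hf h]
    · rintro rfl
      exact ⟨⟨_, rfl⟩, hbe y⟩

/-- A `d`-regular bipartite multigraph has a `j`-regular spanning subgraph for each `j ≤ d`. -/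
lemma exists_factor_of_card_fiber_eq {a : ι → α} {b : ι → β} {A : Finset α}
    {B : Finset β} {E : Finset ι} {d j : ℕ} (hj : j ≤ d)
    (ha : ∀ x ∈ E, a x ∈ A) (hb : ∀ x ∈ E, b x ∈ B)
    (hA : ∀ y ∈ A, #{x ∈ E | a x = y} = d) (hB : ∀ z ∈ B, #{x ∈ E | b x = z} = d) :
    ∃ M ⊆ E, (∀ y ∈ A, #{x ∈ M | a x = y} = j) ∧ ∀ z ∈ B, #{x ∈ M | b x = z} = j := by
  induction hj using Nat.decreasingInduction with
  | self => exact ⟨E, Subset.rfl, hA, hB⟩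
  | of_succ j _ ih =>
    obtain ⟨M, hM, hMA, hMB⟩ := ih
    obtain ⟨N, hN, hNA, hNB⟩ := exists_perfect_matching_of_card_fiber_eq j.succ_pos
      (fun x hx ↦ ha x (hM hx)) (fun x hx ↦ hb x (hM hx)) hMA hMB
    have hsdiff : ∀ (P : ι → Prop) [DecidablePred P], #{x ∈ M | P x} = j + 1 →
        #{x ∈ N | P x} = 1 → #{x ∈ M \ N | P x} = j := by
      intro P _ h1 h2
      have : ({x ∈ M \ N | P x} : Finset ι) = {x ∈ M | P x} \ {x ∈ N | P x} := by
        ext x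
        simp only [mem_filter, mem_sdiff]
        tauto
      rw [this, card_sdiff_of_subset (filter_subset_filter _ hN), h1, h2, Nat.add_sub_cancel]
    exact ⟨M \ N, sdiff_subset.trans hM, fun y hy ↦ hsdiff _ (hMA y hy) (hNA y hy),
      fun z hz ↦ hsdiff _ (hMB z hz) (hNB z hz)⟩

end Factor

theorem stmt_5 {V : Type*} [Fintype V] (G : SimpleGraph V) (k : ℕ) (hk : 1 ≤ k)
    (X Y : Set V)
    (hpart : ∀ v : V, v ∈ X ↔ v ∉ Y)
    (hbip : ∀ u v : V, G.Adj u v → (u ∈ X ↔ v ∈ Y))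
    (hdegX : ∀ x ∈ X, (G.neighborSet x).ncard = 2)
    (hdegY : ∀ y ∈ Y, (G.neighborSet y).ncard = 2 * k + 1)
    (hnocycle : ∀ (v : V) (c : G.Walk v v), c.IsCycle → c.length % 4 ≠ 2) :
    ∃ φ : V → Fin 2, LocallyBalancedOpen G φ := by
  classical
  obtain ⟨c⟩ : (G.commonNeighborGraph_s5 Y).Colorable 2 := by
    refine SimpleGraph.two_colorable_of_even_cycles fun v p hp ↦ ?_
    obtain ⟨q, hq, hlen⟩ := SimpleGraph.exists_subdivided_cycle hpart hbip hdegX p hp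
    have := hnocycle v q hq
    rw [Nat.even_iff]
    omega
  have hends : ∀ x, ∃ y z, x ∈ X →
      G.neighborSet x = {y, z} ∧ y ∈ Y ∧ z ∈ Y ∧ c y = 0 ∧ c z = 1 := by
    intro x
    by_cases hx : x ∈ X
    · obtain ⟨y, z, hyz, hN⟩ := Set.ncard_eq_two.mp (hdegX x hx)
      have hxy : G.Adj x y := by simp [← SimpleGraph.mem_neighborSet, hN]
      have hxz : G.Adj x z := by simp [← SimpleGraph.mem_neighborSet, hN]
      have hy := (hbip _ _ hxy).1 hx
      have hz := (hbip _ _ hxz).1 hx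
      have hc : c y ≠ c z := c.valid ⟨hyz, hy, hz, x, hxy, hxz⟩
      by_cases h0 : c y = 0
      · exact ⟨y, z, fun _ ↦ ⟨hN, hy, hz, h0, by omega⟩⟩
      · exact ⟨z, y, fun _ ↦ ⟨hN.trans (Set.pair_comm _ _), hz, hy, by omega, by omega⟩⟩
    · exact ⟨x, x, fun h ↦ absurd h hx⟩
  choose a b hab using hends
  have hadj0 : ∀ y ∈ Y, c y = 0 → ∀ x, G.Adj y x ↔ x ∈ X ∧ a x = y := by
    intro y hy hcy x
    constructor
    · intro h
      have hx : x ∈ X := (hbip _ _ h.symm).2 hy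
      obtain ⟨hN, -, -, h0, h1⟩ := hab x hx
      have hmem : y ∈ G.neighborSet x := h.symm
      rw [hN] at hmem
      rcases hmem with rfl | rfl
      · exact ⟨hx, rfl⟩
      · omega
    · rintro ⟨hx, rfl⟩
      have : a x ∈ G.neighborSet x := by simp [(hab x hx).1]
      exact this.symm
  have hadj1 : ∀ y ∈ Y, c y = 1 → ∀ x, G.Adj y x ↔ x ∈ X ∧ b x = y := by
    intro y hy hcy x
    constructor
    · intro h
      have hx : x ∈ X := (hbip _ _ h.symm).2 hy
      obtain ⟨hN, -, -, h0, h1⟩ := hab x hx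
      have hmem : y ∈ G.neighborSet x := h.symm
      rw [hN] at hmem
      rcases hmem with rfl | rfl
      · omega
      · exact ⟨hx, rfl⟩
    · rintro ⟨hx, rfl⟩
      have : b x ∈ G.neighborSet x := by simp [(hab x hx).1]
      exact this.symm
  obtain ⟨M, hM, hMA, hMB⟩ := exists_factor_of_card_fiber_eq (a := a) (b := b)
    (A := {y | y ∈ Y ∧ c y = 0}) (B := {y | y ∈ Y ∧ c y = 1}) (E := {x | x ∈ X})
    (d := 2 * k + 1) (j := k) (by omega)
    (fun x hx ↦ by
      have := hab x (by simpa using hx)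
      simp [this])
    (fun x hx ↦ by
      have := hab x (by simpa using hx)
      simp [this])
    (fun y hy ↦ by
      simp only [mem_filter, mem_univ, true_and] at hy
      rw [← hdegY y hy.1, ← Set.ncard_coe_finset]
      congr 1
      ext x
      simp [hadj0 y hy.1 hy.2])
    (fun y hy ↦ by
      simp only [mem_filter, mem_univ, true_and] at hy
      rw [← hdegY y hy.1, ← Set.ncard_coe_finset]
      congr 1
      ext x
      simp [hadj1 y hy.1 hy.2])
  have hMX : ∀ x ∈ M, x ∈ X := fun x hx ↦ by simpa using hM hx
  refine ⟨fun v ↦ if v ∈ Y then c v else if v ∈ M then 0 else 1, fun v ↦ ?_⟩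
  set φ : V → Fin 2 := fun v ↦ if v ∈ Y then c v else if v ∈ M then 0 else 1 with hφ
  have hφX : ∀ x ∈ X, (φ x = 0 ↔ x ∈ M) := by
    intro x hx
    simp [hφ, (hpart x).1 hx]
  have hsum : {u | G.Adj v u ∧ φ u = 0}.ncard + {u | G.Adj v u ∧ φ u = 1}.ncard =
      (G.neighborSet v).ncard := by
    rw [← Set.ncard_union_eq]
    · congr 1
      ext u
      simp only [Set.mem_union, Set.mem_ofPred_eq, SimpleGraph.mem_neighborSet]
      have : φ u = 0 ∨ φ u = 1 := by omega
      tauto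
    · rw [Set.disjoint_left]
      rintro u ⟨-, h0⟩ ⟨-, h1⟩
      omega
  by_cases hv : v ∈ Y
  · have hzero : {u | G.Adj v u ∧ φ u = 0}.ncard = k := by
      rcases (by omega : c v = 0 ∨ c v = 1) with hcv | hcv
      · rw [← hMA v (by simp [hv, hcv]), ← Set.ncard_coe_finset]
        congr 1
        ext x
        simp only [Set.mem_ofPred_eq, hadj0 v hv hcv, coe_filter]
        grind
      · rw [← hMB v (by simp [hv, hcv]), ← Set.ncard_coe_finset]
        congr 1
        ext x
        simp only [Set.mem_ofPred_eq, hadj1 v hv hcv, coe_filter]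
        grind
    rw [hdegY v hv] at hsum
    rw [abs_le]
    omega
  · have hvX := (hpart v).2 hv
    obtain ⟨hN, ha, hb, h0, h1⟩ := hab v hvX
    have hzero : {u | G.Adj v u ∧ φ u = 0}.ncard = 1 := by
      rw [Set.ncard_eq_one]
      refine ⟨a v, Set.ext fun u ↦ ?_⟩
      simp only [Set.mem_ofPred_eq, ← SimpleGraph.mem_neighborSet, hN, Set.mem_singleton_iff,
        Set.mem_insert_iff]
      grind
    rw [hdegX v hvX] at hsum
    rw [abs_le]
    omega
end

section
/- Fix integers r ≥ 1, n ≥ 1 and k ≥ 1. Let x₁, …, x_n be Boolean variables and c₁, …, c_k be monotone 3-clauses over them (each cⱼ is a 3-element set of variables) such that every variable appears in exactly four clauses. Define the bipartite graph G with parts X = {p₁, …, p_n} and Y = {q_j^l : 1 ≤ j ≤ k, 1 ≤ l ≤ 2r}, where p_i is adjacent to q_j^l if and only if x_i ∈ c_j. Then G has a locally-balanced 2-partition with an open neighborhood if and only if there exists an assignment β : {x₁, …, x_n} → {0,1} that NAE-satisfies every clause c₁, …, c_k. -/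
/-- An assignment `β` NAE-satisfies a monotone clause `c` (a set of variables) if the
variables of `c` do not all receive the same value under `β`. -/
def NAESat {n : ℕ} (c : Finset (Fin n)) (β : Fin n → Fin 2) : Prop :=
  ¬ ∃ b : Fin 2, ∀ i ∈ c, β i = b

/-- The bipartite graph with parts `X = {p₁, …, p_n}` (encoded as `Sum.inl i`) and
`Y = {q_j^l : 1 ≤ j ≤ k, 1 ≤ l ≤ 2r}` (encoded as `Sum.inr (j, l)`), where `p_i` is
adjacent to `q_j^l` iff the variable `x_i` belongs to the clause `c_j`. -/
def clauseGraph (n k r : ℕ) (c : Fin k → Finset (Fin n)) :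
    SimpleGraph (Fin n ⊕ Fin k × Fin (2 * r)) :=
  SimpleGraph.fromRel (fun a b =>
    ∃ (i : Fin n) (j : Fin k) (l : Fin (2 * r)),
      a = Sum.inl i ∧ b = Sum.inr (j, l) ∧ i ∈ c j)

theorem clauseGraph_adj_inl {n k r : ℕ} {c : Fin k → Finset (Fin n)} (i : Fin n)
    (v : Fin n ⊕ Fin k × Fin (2 * r)) :
    (clauseGraph n k r c).Adj (Sum.inl i) v ↔ ∃ j l, v = Sum.inr (j, l) ∧ i ∈ c j := by
  rcases v with v | ⟨j, l⟩ <;> simp [clauseGraph]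

theorem clauseGraph_adj_inr {n k r : ℕ} {c : Fin k → Finset (Fin n)} (j : Fin k)
    (l : Fin (2 * r)) (v : Fin n ⊕ Fin k × Fin (2 * r)) :
    (clauseGraph n k r c).Adj (Sum.inr (j, l)) v ↔ ∃ i, v = Sum.inl i ∧ i ∈ c j := by
  rcases v with v | v <;> simp [clauseGraph]

theorem ncard_clauseGraph_adj_inr {n k r : ℕ} {c : Fin k → Finset (Fin n)}
    (φ : Fin n ⊕ Fin k × Fin (2 * r) → Fin 2) (j : Fin k) (l : Fin (2 * r)) (b : Fin 2) :
    {u | (clauseGraph n k r c).Adj (Sum.inr (j, l)) u ∧ φ u = b}.ncard =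
      ((c j).filter (fun i => φ (Sum.inl i) = b)).card := by
  rw [← Set.ncard_coe_finset,
    ← Set.ncard_image_of_injective (β := Fin n ⊕ Fin k × Fin (2 * r)) _ Sum.inl_injective]
  congr 1
  ext v
  rcases v with v | v <;> simp [clauseGraph_adj_inr]

/-- A clause with three variables is NAE-satisfied iff the two classes of its variables differ
in size by at most one. -/
theorem naeSat_iff_abs_sub_le {n : ℕ} {c : Finset (Fin n)} (hc : c.card = 3)
    (β : Fin n → Fin 2) :
    NAESat c β ↔ |(((c.filter (fun i => β i = 0)).card : ℤ) -
      ((c.filter (fun i => β i = 1)).card : ℤ))| ≤ 1 := by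
  have hne : ∀ i, ¬ β i = 0 ↔ β i = 1 := fun i => by omega
  have hsum := Finset.card_filter_add_card_filter_not (s := c) (fun i => β i = 0)
  have hall : ∀ b, (∀ i ∈ c, β i = b) ↔ (c.filter (fun i => β i = b)).card = 3 := fun b => by
    rw [← hc, Finset.card_filter_eq_iff]
  simp only [hne, hc] at hsum
  simp only [NAESat, hall, Fin.exists_fin_two, abs_le]
  omega

/-- Extend an assignment to the clause vertices by the parity of the copy index. -/
def parityExtension {n k r : ℕ} (β : Fin n → Fin 2) : Fin n ⊕ Fin k × Fin (2 * r) → Fin 2 :=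
  Sum.elim β (fun q => Fin.ofNat 2 q.2.val)

theorem parityExtension_rev {n k r : ℕ} (β : Fin n → Fin 2) (j : Fin k) (l : Fin (2 * r)) :
    parityExtension β (Sum.inr (j, l.rev)) = 0 ↔ parityExtension β (Sum.inr (j, l)) = 1 := by
  simp only [parityExtension, Sum.elim_inr, Fin.ext_iff, Fin.val_ofNat, Fin.val_rev,
    Fin.val_zero, Fin.val_one]
  omega

theorem ncard_parityExtension_inl {n k r : ℕ} {c : Fin k → Finset (Fin n)}
    (β : Fin n → Fin 2) (i : Fin n) :
    {u | (clauseGraph n k r c).Adj (Sum.inl i) u ∧ parityExtension β u = 0}.ncard =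
      {u | (clauseGraph n k r c).Adj (Sum.inl i) u ∧ parityExtension β u = 1}.ncard := by
  have hinj : Function.Injective (Sum.map id (Prod.map id Fin.rev) :
      Fin n ⊕ Fin k × Fin (2 * r) → Fin n ⊕ Fin k × Fin (2 * r)) :=
    Function.injective_id.sumMap (Function.injective_id.prodMap Fin.rev_injective)
  rw [← Set.ncard_image_of_injective {u | _ ∧ parityExtension β u = 1} hinj]
  congr 1
  ext v
  simp only [Set.mem_ofPred_eq, Set.mem_image, clauseGraph_adj_inl]
  constructor
  · rintro ⟨⟨j, l, rfl, hj⟩, hv⟩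
    refine ⟨Sum.inr (j, l.rev), ⟨⟨j, l.rev, rfl, hj⟩, ?_⟩, by simp⟩
    rwa [← parityExtension_rev, Fin.rev_rev]
  · rintro ⟨_, ⟨⟨j, l, rfl, hj⟩, hv⟩, rfl⟩
    exact ⟨⟨j, l.rev, rfl, hj⟩, (parityExtension_rev β j l).2 hv⟩

theorem stmt_8 (r n k : ℕ) (hr : 1 ≤ r) (hn : 1 ≤ n) (hk : 1 ≤ k)
    (c : Fin k → Finset (Fin n))
    (hc : ∀ j, (c j).card = 3)
    (hvar : ∀ i : Fin n, (Finset.univ.filter (fun j => i ∈ c j)).card = 4) :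
    (∃ φ, LocallyBalancedOpen (clauseGraph n k r c) φ) ↔
      ∃ β : Fin n → Fin 2, ∀ j, NAESat (c j) β := by
  constructor
  · rintro ⟨φ, hφ⟩
    refine ⟨φ ∘ Sum.inl, fun j => ?_⟩
    have h := hφ (Sum.inr (j, ⟨0, by omega⟩))
    rw [ncard_clauseGraph_adj_inr, ncard_clauseGraph_adj_inr] at h
    exact (naeSat_iff_abs_sub_le (hc j) _).2 h
  · rintro ⟨β, hβ⟩
    refine ⟨parityExtension β, ?_⟩
    rintro (i | ⟨j, l⟩)
    · simp [ncard_parityExtension_inl]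
    · rw [ncard_clauseGraph_adj_inr, ncard_clauseGraph_adj_inr]
      exact (naeSat_iff_abs_sub_le (hc j) _).1 (hβ j)
end

section
/- Let F₂ be the graph on six vertices v₁, v₂, v₃, v₄, v₅, v₆ with edge set {v₁v₃, v₂v₃, v₃v₄, v₄v₅, v₄v₆}. If φ is a locally-balanced 2-partition of F₂ with a closed neighborhood, then φ(v₁) = φ(v₂) = φ(v₅) = φ(v₆) and φ(v₃) = φ(v₄) = 1 − φ(v₁). -/
/-- A 2-partition `φ : V → Fin 2` of a simple graph `G` is locally-balanced with a
closed neighborhood if for every vertex `v`, the numbers of vertices of the closed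
neighborhood `N_G[v]` in the two classes differ by at most one. -/
def LocallyBalancedClosed {V : Type*} (G : SimpleGraph V) (φ : V → Fin 2) : Prop :=
  ∀ v : V,
    |(({u | (G.Adj v u ∨ u = v) ∧ φ u = 0}.ncard : ℤ) -
      ({u | (G.Adj v u ∨ u = v) ∧ φ u = 1}.ncard : ℤ))| ≤ 1

/-- The graph `F₂` on the six vertices `v₁, …, v₆` (encoded as `0, …, 5 : Fin 6`) with
edge set `{v₁v₃, v₂v₃, v₃v₄, v₄v₅, v₄v₆}`. -/
def F₂ : SimpleGraph (Fin 6) :=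
  SimpleGraph.fromRel (fun a b =>
    (a = 0 ∧ b = 2) ∨ (a = 1 ∧ b = 2) ∨ (a = 2 ∧ b = 3) ∨ (a = 3 ∧ b = 4) ∨
      (a = 3 ∧ b = 5))

instance : DecidableRel F₂.Adj := fun a b =>
  decidable_of_iff _ (SimpleGraph.fromRel_adj _ a b).symm

theorem locallyBalancedClosed_iff_card {V : Type*} [Fintype V] [DecidableEq V]
    (G : SimpleGraph V) [DecidableRel G.Adj] (φ : V → Fin 2) :
    LocallyBalancedClosed G φ ↔ ∀ v : V,
      |((Finset.univ.filter fun u => (G.Adj v u ∨ u = v) ∧ φ u = 0).card : ℤ) -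
        ((Finset.univ.filter fun u => (G.Adj v u ∨ u = v) ∧ φ u = 1).card : ℤ)| ≤ 1 := by
  simp only [LocallyBalancedClosed, ← Set.ncard_coe_finset, Finset.coe_filter,
    Finset.mem_univ, true_and]

theorem stmt_12 (φ : Fin 6 → Fin 2) (hφ : LocallyBalancedClosed F₂ φ) :
    (φ 0 = φ 1 ∧ φ 1 = φ 4 ∧ φ 4 = φ 5) ∧ (φ 2 = φ 3 ∧ φ 2 = 1 - φ 0) := by
  rw [locallyBalancedClosed_iff_card] at hφ
  have h0 := hφ 0
  have h1 := hφ 1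
  have h2 := hφ 2
  have h3 := hφ 3
  have h4 := hφ 4
  have h5 := hφ 5
  clear hφ
  simp only [Finset.card_filter, Fin.sum_univ_six, F₂, SimpleGraph.fromRel_adj] at *
  generalize φ 0 = a, φ 1 = b, φ 2 = c, φ 3 = d, φ 4 = e, φ 5 = f at *
  simp at h0 h1 h2 h3 h4 h5
  revert a b c d e f
  decide
end

section
/- Let G be a finite simple graph containing six distinct vertices v₁, v₂, v₃, v₄, v₅, v₆ such that the neighborhood of v₃ in G is exactly {v₁, v₂, v₄}, the neighborhood of v₄ in G is exactly {v₃, v₅, v₆}, and v₅ and v₆ each have degree exactly 1 in G. If φ is a locally-balanced 2-partition of G with a closed neighborhood, then φ(v₁) = φ(v₂) = φ(v₅) = φ(v₆) and φ(v₃) = φ(v₄) = 1 − φ(v₁). -/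
/-- Local balance at `v` bounds the signed sum of the labels over the closed neighborhood. -/
theorem LocallyBalancedClosed.abs_sum_le {V : Type*} {G : SimpleGraph V} {φ : V → Fin 2}
    (hφ : LocallyBalancedClosed G φ) {v : V} {s : Finset V}
    (hs : ∀ u, u ∈ s ↔ G.Adj v u ∨ u = v) :
    |∑ u ∈ s, if φ u = 0 then (1 : ℤ) else -1| ≤ 1 := by
  have key : ∀ c : Fin 2,
      {u | (G.Adj v u ∨ u = v) ∧ φ u = c}.ncard = (s.filter (φ · = c)).card := by
    intro c
    rw [← Set.ncard_coe_finset]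
    congr 1
    ext u
    simp [hs]
  have h := hφ v
  rw [key, key] at h
  convert h using 2
  have h1 : s.filter (φ · = 1) = s.filter (¬ φ · = 0) := by
    ext u
    simp only [Finset.mem_filter]
    have : φ u = 1 ↔ ¬ φ u = 0 := by omega
    rw [this]
  rw [h1, Finset.sum_ite]
  simp [sub_eq_add_neg]

/-- A pendant vertex and its neighbor lie in different classes. -/
theorem LocallyBalancedClosed.ne_of_ncard_neighborSet_eq_one {V : Type*} {G : SimpleGraph V}
    {φ : V → Fin 2} (hφ : LocallyBalancedClosed G φ) {v w : V} (hvw : G.Adj v w)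
    (hv : (G.neighborSet v).ncard = 1) : φ v ≠ φ w := by
  classical
  obtain ⟨a, ha⟩ := Set.ncard_eq_one.mp hv
  have hadj : ∀ u, G.Adj v u ↔ u = a := fun u => by
    rw [← G.mem_neighborSet, ha, Set.mem_singleton_iff]
  obtain rfl := (hadj w).mp hvw
  have h := hφ.abs_sum_le (v := v) (s := {v, w}) (by intro u; simp [hadj, or_comm])
  rw [Finset.sum_pair hvw.ne] at h
  intro heq
  rw [heq] at h
  split_ifs at h <;> norm_num at h

/-- A vertex of degree three has exactly two vertices of each class in its closed neighborhood. -/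
theorem LocallyBalancedClosed.sum_eq_two_of_neighborSet_eq {V : Type*} {G : SimpleGraph V}
    {φ : V → Fin 2} (hφ : LocallyBalancedClosed G φ) {v a b c : V}
    (hv : G.neighborSet v = {a, b, c}) (hab : a ≠ b) (hac : a ≠ c) (hbc : b ≠ c) :
    (φ v : ℕ) + φ a + φ b + φ c = 2 := by
  classical
  have hadj : ∀ u, G.Adj v u ↔ u = a ∨ u = b ∨ u = c := fun u => by
    rw [← G.mem_neighborSet, hv]; simp
  have hva : v ≠ a := ((hadj a).mpr (by simp)).ne
  have hvb : v ≠ b := ((hadj b).mpr (by simp)).ne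
  have hvc : v ≠ c := ((hadj c).mpr (by simp)).ne
  have h := hφ.abs_sum_le (v := v) (s := {v, a, b, c}) (by intro u; simp [hadj]; tauto)
  rw [Finset.sum_insert (by simp [hva, hvb, hvc]), Finset.sum_insert (by simp [hab, hac]),
    Finset.sum_pair hbc, abs_le] at h
  split_ifs at h <;> omega

theorem stmt_13 {V : Type*} [Fintype V] (G : SimpleGraph V)
    (v₁ v₂ v₃ v₄ v₅ v₆ : V)
    (hdistinct : [v₁, v₂, v₃, v₄, v₅, v₆].Nodup)
    (hnb₃ : G.neighborSet v₃ = {v₁, v₂, v₄})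
    (hnb₄ : G.neighborSet v₄ = {v₃, v₅, v₆})
    (hd₅ : (G.neighborSet v₅).ncard = 1)
    (hd₆ : (G.neighborSet v₆).ncard = 1)
    (φ : V → Fin 2) (hφ : LocallyBalancedClosed G φ) :
    (φ v₁ = φ v₂ ∧ φ v₂ = φ v₅ ∧ φ v₅ = φ v₆) ∧
      (φ v₃ = φ v₄ ∧ φ v₃ = 1 - φ v₁) := by
  simp only [List.nodup_cons, List.mem_cons, List.not_mem_nil, not_or] at hdistinct
  have h₄₅ : G.Adj v₄ v₅ := by rw [← G.mem_neighborSet, hnb₄]; simp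
  have h₄₆ : G.Adj v₄ v₆ := by rw [← G.mem_neighborSet, hnb₄]; simp
  have h₅ := hφ.ne_of_ncard_neighborSet_eq_one h₄₅.symm hd₅
  have h₆ := hφ.ne_of_ncard_neighborSet_eq_one h₄₆.symm hd₆
  have h₃ := hφ.sum_eq_two_of_neighborSet_eq hnb₃ (by tauto) (by tauto) (by tauto)
  have h₄ := hφ.sum_eq_two_of_neighborSet_eq hnb₄ (by tauto) (by tauto) (by tauto)
  omega
end

section
/- Let n, k ≥ 1, let x₁, …, x_n be Boolean variables and c₁, …, c_k be monotone 3-clauses over them (each cⱼ is a 3-element set of variables) such that every variable appears in exactly four clauses; for each variable x_i, enumerate the four clauses containing it as its 1st through 4th appearances. Define the graph G as follows. For each variable x_i take a 16-cycle on vertices p₁^i, u₁^i, u₂^i, u₃^i, p₂^i, u₄^i, u₅^i, u₆^i, p₃^i, u₇^i, u₈^i, u₉^i, p₄^i, u₁₀^i, u₁₁^i, u₁₂^i (in this cyclic order). For each clause cⱼ take three additional vertices q_j¹, q_j², v_j with q_j¹v_j and q_j²v_j edges. Additionally, join p_t^i to both q_j¹ and q_j² whenever x_i ∈ c_j and cⱼ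 is the t-th appearance of x_i. Then G is an even bipartite graph with maximum degree 4, and G has a locally-balanced 2-partition with an open neighborhood if and only if there exists an assignment β : {x₁, …, x_n} → {0,1} that NAE-satisfies every clause c₁, …, c_k. -/
/-- The gadget graph: for each variable `x_i` a 16-cycle on the vertices
`Sum.inl (i, 0), …, Sum.inl (i, 15)` (in this cyclic order), where
`p_t^i = Sum.inl (i, 4 * (t - 1))` for `1 ≤ t ≤ 4` and the remaining twelve vertices
are `u₁^i, …, u₁₂^i`; for each clause `c_j` the three vertices
`q_j¹ = Sum.inr (j, 0)`, `q_j² = Sum.inr (j, 1)`, `v_j = Sum.inr (j, 2)` with edges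
`q_j¹v_j` and `q_j²v_j`; and edges joining `p_t^i` to both `q_j¹` and `q_j²` whenever
`c_j` is the `t`-th clause containing `x_i` (given by the enumeration `app`). -/
def gadgetGraph (n k : ℕ) (app : Fin n → Fin 4 → Fin k) :
    SimpleGraph ((Fin n × Fin 16) ⊕ (Fin k × Fin 3)) :=
  SimpleGraph.fromRel (fun a b =>
    (∃ (i : Fin n) (x : Fin 16), a = Sum.inl (i, x) ∧ b = Sum.inl (i, x + 1)) ∨
    (∃ j : Fin k, a = Sum.inr (j, 0) ∧ b = Sum.inr (j, 2)) ∨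
    (∃ j : Fin k, a = Sum.inr (j, 1) ∧ b = Sum.inr (j, 2)) ∨
    (∃ (i : Fin n) (t : Fin 4) (l : Fin 3), l ≠ 2 ∧
      a = Sum.inl (i, ⟨4 * t.1, by omega⟩) ∧ b = Sum.inr (app i t, l)))

section LocalBalance

variable {V : Type*} {G : SimpleGraph V}

/-- The signed count of the colours on a finite neighbourhood. -/
theorem ncard_sub_ncard_eq_sum (φ : V → Fin 2) {v : V} {s : Finset V}
    (hs : ∀ u, G.Adj v u ↔ u ∈ s) :
    (({u | G.Adj v u ∧ φ u = 0}.ncard : ℤ) - ({u | G.Adj v u ∧ φ u = 1}.ncard : ℤ)) =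
      ∑ u ∈ s, (1 - 2 * ((φ u).val : ℤ)) := by
  have key : ∀ b : Fin 2, {u | G.Adj v u ∧ φ u = b} = ↑(s.filter (fun u => φ u = b)) := by
    intro b
    ext u
    simp [hs]
  rw [key, key, Set.ncard_coe_finset, Set.ncard_coe_finset, Finset.card_filter,
    Finset.card_filter]
  push_cast
  rw [← Finset.sum_sub_distrib]
  refine Finset.sum_congr rfl fun u _ => ?_
  generalize φ u = b
  revert b
  decide

theorem balanced_pair_iff (φ : V → Fin 2) {v a b : V} (hab : a ≠ b)
    (hs : ∀ u, G.Adj v u ↔ u = a ∨ u = b) :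
    |(({u | G.Adj v u ∧ φ u = 0}.ncard : ℤ) - ({u | G.Adj v u ∧ φ u = 1}.ncard : ℤ))| ≤ 1 ↔
      φ a ≠ φ b := by
  classical
  rw [ncard_sub_ncard_eq_sum φ (s := {a, b}) (by simpa using hs), Finset.sum_pair hab]
  generalize φ a = x
  generalize φ b = y
  revert x y
  decide

theorem balanced_quadruple_iff (φ : V → Fin 2) {v a b c d : V} (hnodup : [a, b, c, d].Nodup)
    (hs : ∀ u, G.Adj v u ↔ u = a ∨ u = b ∨ u = c ∨ u = d) :
    |(({u | G.Adj v u ∧ φ u = 0}.ncard : ℤ) - ({u | G.Adj v u ∧ φ u = 1}.ncard : ℤ))| ≤ 1 ↔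
      (φ a).val + (φ b).val + (φ c).val + (φ d).val = 2 := by
  classical
  rw [ncard_sub_ncard_eq_sum φ (s := [a, b, c, d].toFinset) (by simpa using hs),
    List.sum_toFinset _ hnodup]
  simp only [List.map_cons, List.map_nil, List.sum_cons, List.sum_nil]
  generalize φ a = x
  generalize φ b = y
  generalize φ c = z
  generalize φ d = w
  revert x y z w
  decide

theorem ncard_neighborSet_pair {v a b : V} (hab : a ≠ b)
    (hs : ∀ u, G.Adj v u ↔ u = a ∨ u = b) : (G.neighborSet v).ncard = 2 := by
  have h : G.neighborSet v = {a, b} := by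
    ext u
    simp [hs]
  rw [h, Set.ncard_pair hab]

theorem ncard_neighborSet_quadruple {v a b c d : V} (hnodup : [a, b, c, d].Nodup)
    (hs : ∀ u, G.Adj v u ↔ u = a ∨ u = b ∨ u = c ∨ u = d) :
    (G.neighborSet v).ncard = 4 := by
  classical
  have h : G.neighborSet v = ↑([a, b, c, d].toFinset) := by
    ext u
    simp [hs]
  rw [h, Set.ncard_coe_finset, List.toFinset_card_of_nodup hnodup]
  rfl

end LocalBalance

section GadgetGraph

variable {n k : ℕ} {app : Fin n → Fin 4 → Fin k}

/-- The position on the 16-cycle of the vertex used for the `t`-th appearance. -/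
def portPosition (t : Fin 4) : Fin 16 := ⟨4 * t.1, by omega⟩

theorem gadgetGraph_adj_inl_inl {i i' : Fin n} {x y : Fin 16} :
    (gadgetGraph n k app).Adj (Sum.inl (i, x)) (Sum.inl (i', y)) ↔
      i' = i ∧ (y = x + 1 ∨ y = x - 1) := by
  have hsucc : ∀ x : Fin 16, x ≠ x + 1 := by decide
  have hpred : ∀ x : Fin 16, x ≠ x - 1 := by decide
  have hshift : ∀ x y : Fin 16, x = y + 1 ↔ y = x - 1 := by decide
  rw [gadgetGraph, SimpleGraph.fromRel_adj]
  simp only [Sum.inl.injEq, Prod.mk.injEq, reduceCtorEq, and_false, exists_false,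
    or_false, ne_eq]
  constructor
  · rintro ⟨-, ⟨a, z, ⟨rfl, rfl⟩, rfl, rfl⟩ | ⟨a, z, ⟨rfl, rfl⟩, rfl, rfl⟩⟩
    · exact ⟨rfl, Or.inl rfl⟩
    · exact ⟨rfl, Or.inr ((hshift _ _).1 rfl)⟩
  · rintro ⟨rfl, rfl | rfl⟩
    · exact ⟨fun h => hsucc x h.2, Or.inl ⟨_, _, ⟨rfl, rfl⟩, rfl, rfl⟩⟩
    · exact ⟨fun h => hpred x h.2, Or.inr ⟨_, _, ⟨rfl, rfl⟩, rfl, (hshift _ _).2 rfl⟩⟩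

theorem gadgetGraph_adj_inl_inr {i : Fin n} {x : Fin 16} {j : Fin k} {l : Fin 3} :
    (gadgetGraph n k app).Adj (Sum.inl (i, x)) (Sum.inr (j, l)) ↔
      l ≠ 2 ∧ ∃ t, x = portPosition t ∧ app i t = j := by
  rw [gadgetGraph, SimpleGraph.fromRel_adj]
  simp only [Sum.inl.injEq, Sum.inr.injEq, Prod.mk.injEq, reduceCtorEq, false_and, and_false,
    exists_false, or_false, false_or, ne_eq, not_false_eq_true, true_and]
  constructor
  · rintro ⟨a, t, m, hm, ⟨rfl, rfl⟩, rfl, rfl⟩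
    exact ⟨hm, t, rfl, rfl⟩
  · rintro ⟨hl, t, rfl, rfl⟩
    exact ⟨i, t, l, hl, ⟨rfl, rfl⟩, rfl, rfl⟩

theorem gadgetGraph_adj_inr_inr {j j' : Fin k} {l m : Fin 3} :
    (gadgetGraph n k app).Adj (Sum.inr (j, l)) (Sum.inr (j', m)) ↔
      j' = j ∧ (l = 2 ↔ m ≠ 2) := by
  rw [gadgetGraph, SimpleGraph.fromRel_adj]
  simp only [Sum.inr.injEq, Prod.mk.injEq, reduceCtorEq, false_and, and_false,
    exists_false, or_false, false_or, ne_eq]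
  constructor
  · rintro ⟨-, (⟨a, ⟨rfl, rfl⟩, rfl, rfl⟩ | ⟨a, ⟨rfl, rfl⟩, rfl, rfl⟩) |
      ⟨a, ⟨rfl, rfl⟩, rfl, rfl⟩ | ⟨a, ⟨rfl, rfl⟩, rfl, rfl⟩⟩ <;> simp
  · rintro ⟨rfl, h⟩
    fin_cases l <;> fin_cases m <;> simp at h ⊢

theorem gadgetGraph_adj_cycle_iff {i : Fin n} {x : Fin 16} (hx : ∀ t, x ≠ portPosition t)
    (u : (Fin n × Fin 16) ⊕ (Fin k × Fin 3)) :
    (gadgetGraph n k app).Adj (Sum.inl (i, x)) u ↔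
      u = Sum.inl (i, x + 1) ∨ u = Sum.inl (i, x - 1) := by
  rcases u with ⟨i', y⟩ | ⟨j, l⟩
  · rw [gadgetGraph_adj_inl_inl]
    simp only [Sum.inl.injEq, Prod.mk.injEq]
    tauto
  · rw [gadgetGraph_adj_inl_inr]
    simp [hx]

theorem gadgetGraph_adj_port_iff {i : Fin n} {t : Fin 4}
    (u : (Fin n × Fin 16) ⊕ (Fin k × Fin 3)) :
    (gadgetGraph n k app).Adj (Sum.inl (i, portPosition t)) u ↔
      u = Sum.inl (i, portPosition t + 1) ∨ u = Sum.inl (i, portPosition t - 1) ∨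
        u = Sum.inr (app i t, 0) ∨ u = Sum.inr (app i t, 1) := by
  have hport : ∀ s t, portPosition s = portPosition t ↔ s = t := by decide
  rcases u with ⟨i', y⟩ | ⟨j, l⟩
  · rw [gadgetGraph_adj_inl_inl]
    simp only [Sum.inl.injEq, Prod.mk.injEq, reduceCtorEq, or_false]
    tauto
  · rw [gadgetGraph_adj_inl_inr]
    have hl : l ≠ 2 ↔ l = 0 ∨ l = 1 := by revert l; decide
    simp only [hport, exists_eq_left', hl, reduceCtorEq, false_or, Sum.inr.injEq, Prod.mk.injEq]
    rw [eq_comm (a := app i t)]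
    tauto

theorem gadgetGraph_adj_apex_iff {j : Fin k} (u : (Fin n × Fin 16) ⊕ (Fin k × Fin 3)) :
    (gadgetGraph n k app).Adj (Sum.inr (j, 2)) u ↔
      u = Sum.inr (j, 0) ∨ u = Sum.inr (j, 1) := by
  rcases u with ⟨i, x⟩ | ⟨j', l⟩
  · rw [SimpleGraph.adj_comm, gadgetGraph_adj_inl_inr]
    simp
  · rw [gadgetGraph_adj_inr_inr]
    have hl : l ≠ 2 ↔ l = 0 ∨ l = 1 := by revert l; decide
    simp only [hl, true_iff, Sum.inr.injEq, Prod.mk.injEq]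
    tauto

theorem gadgetGraph_adj_clause_iff {j : Fin k} {l : Fin 3} (hl : l ≠ 2)
    {a b c : Fin n} {r s t : Fin 4} (happ_inj : ∀ i, Function.Injective (app i))
    (hclause : ∀ i, (∃ t, app i t = j) ↔ i = a ∨ i = b ∨ i = c)
    (hr : app a r = j) (hs : app b s = j) (ht : app c t = j)
    (u : (Fin n × Fin 16) ⊕ (Fin k × Fin 3)) :
    (gadgetGraph n k app).Adj (Sum.inr (j, l)) u ↔
      u = Sum.inr (j, 2) ∨ u = Sum.inl (a, portPosition r) ∨
        u = Sum.inl (b, portPosition s) ∨ u = Sum.inl (c, portPosition t) := by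
  rcases u with ⟨i, x⟩ | ⟨j', m⟩
  · rw [SimpleGraph.adj_comm, gadgetGraph_adj_inl_inr]
    simp only [reduceCtorEq, false_or, Sum.inl.injEq, Prod.mk.injEq]
    constructor
    · rintro ⟨-, q, rfl, hq⟩
      rcases (hclause i).1 ⟨q, hq⟩ with rfl | rfl | rfl
      · exact Or.inl ⟨rfl, congrArg _ (happ_inj _ (hq.trans hr.symm))⟩
      · exact Or.inr (Or.inl ⟨rfl, congrArg _ (happ_inj _ (hq.trans hs.symm))⟩)
      · exact Or.inr (Or.inr ⟨rfl, congrArg _ (happ_inj _ (hq.trans ht.symm))⟩)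
    · rintro (⟨rfl, rfl⟩ | ⟨rfl, rfl⟩ | ⟨rfl, rfl⟩)
      exacts [⟨hl, r, rfl, hr⟩, ⟨hl, s, rfl, hs⟩, ⟨hl, t, rfl, ht⟩]
  · rw [gadgetGraph_adj_inr_inr]
    simp [hl]

theorem port_neighbours_nodup (i : Fin n) (j : Fin k) (x : Fin 16) :
    [(Sum.inl (i, x + 1) : (Fin n × Fin 16) ⊕ (Fin k × Fin 3)), Sum.inl (i, x - 1),
      Sum.inr (j, 0), Sum.inr (j, 1)].Nodup := by
  have hx : ∀ x : Fin 16, x + 1 ≠ x - 1 := by decide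
  simp [hx]

theorem clause_neighbours_nodup (j : Fin k) {a b c : Fin n} (x y z : Fin 16)
    (hab : a ≠ b) (hac : a ≠ c) (hbc : b ≠ c) :
    [(Sum.inr (j, 2) : (Fin n × Fin 16) ⊕ (Fin k × Fin 3)), Sum.inl (a, x), Sum.inl (b, y),
      Sum.inl (c, z)].Nodup := by
  simp [hab, hac, hbc]

theorem cycle_neighbours_ne (i : Fin n) (x : Fin 16) :
    (Sum.inl (i, x + 1) : (Fin n × Fin 16) ⊕ (Fin k × Fin 3)) ≠ Sum.inl (i, x - 1) := by
  have hx : ∀ x : Fin 16, x + 1 ≠ x - 1 := by decide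
  simp [hx]

theorem apex_neighbours_ne (j : Fin k) :
    (Sum.inr (j, 0) : (Fin n × Fin 16) ⊕ (Fin k × Fin 3)) ≠ Sum.inr (j, 1) := by
  simp

/-- The colour classes: even cycle positions and clause apexes against the rest. -/
def gadgetColoring (app : Fin n → Fin 4 → Fin k) : (gadgetGraph n k app).Coloring (Fin 2) :=
  SimpleGraph.Coloring.mk
    (Sum.elim (fun p => if p.2.val % 2 = 0 then 0 else 1) (fun q => if q.2 = 2 then 0 else 1)) <| by
    have hcycle : ∀ x y : Fin 16, (y = x + 1 ∨ y = x - 1) →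
        (if x.val % 2 = 0 then (0 : Fin 2) else 1) ≠ if y.val % 2 = 0 then 0 else 1 := by decide
    have hport : ∀ t, (portPosition t).val % 2 = 0 := by decide
    rintro (⟨i, x⟩ | ⟨j, l⟩) (⟨i', y⟩ | ⟨j', m⟩) h
    · exact hcycle x y (gadgetGraph_adj_inl_inl.1 h).2
    · obtain ⟨hm, t, rfl, -⟩ := gadgetGraph_adj_inl_inr.1 h
      simp [hm, hport]
    · obtain ⟨hl, t, rfl, -⟩ := gadgetGraph_adj_inl_inr.1 h.symm
      simp [hl, hport]
    · have h' := (gadgetGraph_adj_inr_inr.1 h).2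
      by_cases hl : l = 2 <;> simp_all

/-- Local balance of the gadget graph, written out at each kind of vertex. -/
theorem locallyBalancedOpen_gadgetGraph_iff {c : Fin k → Finset (Fin n)}
    (hc : ∀ j, (c j).card = 3) (happ_inj : ∀ i, Function.Injective (app i))
    (happ_mem : ∀ (i : Fin n) (j : Fin k), (∃ t, app i t = j) ↔ i ∈ c j)
    (φ : (Fin n × Fin 16) ⊕ (Fin k × Fin 3) → Fin 2) :
    LocallyBalancedOpen (gadgetGraph n k app) φ ↔
      (∀ i x, φ (Sum.inl (i, x + 1)) ≠ φ (Sum.inl (i, x - 1))) ∧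
      (∀ j, φ (Sum.inr (j, 0)) ≠ φ (Sum.inr (j, 1))) ∧
      ∀ j, (φ (Sum.inr (j, 2))).val + ∑ i ∈ c j, ∑ t with app i t = j,
        (φ (Sum.inl (i, portPosition t))).val = 2 := by
  have hsum : ∀ (u v x y : Fin 2), u ≠ v → (x.val + y.val + u.val + v.val = 2 ↔ x ≠ y) := by
    decide
  have hclause : ∀ (j : Fin k) (l : Fin 3), l ≠ 2 →
      (|(({u | (gadgetGraph n k app).Adj (Sum.inr (j, l)) u ∧ φ u = 0}.ncard : ℤ) -
        ({u | (gadgetGraph n k app).Adj (Sum.inr (j, l)) u ∧ φ u = 1}.ncard : ℤ))| ≤ 1 ↔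
      (φ (Sum.inr (j, 2))).val + ∑ i ∈ c j, ∑ t with app i t = j,
        (φ (Sum.inl (i, portPosition t))).val = 2) := by
    intro j l hl
    obtain ⟨a, b, d, hab, had, hbd, hj⟩ := Finset.card_eq_three.1 (hc j)
    obtain ⟨r, hr⟩ := (happ_mem a j).2 (by simp [hj])
    obtain ⟨s, hs⟩ := (happ_mem b j).2 (by simp [hj])
    obtain ⟨t, ht⟩ := (happ_mem d j).2 (by simp [hj])
    have hfilter : ∀ i q, app i q = j →
        (Finset.univ.filter fun t => app i t = j) = {q} := by
      rintro i q rfl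
      ext p
      simp [(happ_inj i).eq_iff]
    rw [balanced_quadruple_iff φ (clause_neighbours_nodup j _ _ _ hab had hbd)
      (gadgetGraph_adj_clause_iff hl happ_inj (fun i => by simp [happ_mem, hj]) hr hs ht), hj,
      Finset.sum_insert (by simp [hab, had]), Finset.sum_pair hbd,
      hfilter a r hr, hfilter b s hs, hfilter d t ht]
    simp only [Finset.sum_singleton]
    omega
  constructor
  · intro h
    have hapex : ∀ j, φ (Sum.inr (j, 0)) ≠ φ (Sum.inr (j, 1)) := fun j =>
      (balanced_pair_iff φ (apex_neighbours_ne j) gadgetGraph_adj_apex_iff).1 (h _)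
    refine ⟨fun i x => ?_, hapex, fun j => (hclause j 0 (by decide)).1 (h _)⟩
    by_cases hx : ∃ t, x = portPosition t
    · obtain ⟨t, rfl⟩ := hx
      exact (hsum _ _ _ _ (hapex (app i t))).1 ((balanced_quadruple_iff φ
        (port_neighbours_nodup i (app i t) _) gadgetGraph_adj_port_iff).1 (h _))
    · exact (balanced_pair_iff φ (cycle_neighbours_ne i x)
        (gadgetGraph_adj_cycle_iff (by simpa using hx))).1 (h _)
  · rintro ⟨hcycle, hapex, hbal⟩ (⟨i, x⟩ | ⟨j, l⟩)
    · by_cases hx : ∃ t, x = portPosition t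
      · obtain ⟨t, rfl⟩ := hx
        exact (balanced_quadruple_iff φ (port_neighbours_nodup i (app i t) _)
          gadgetGraph_adj_port_iff).2 ((hsum _ _ _ _ (hapex (app i t))).2 (hcycle i _))
      · exact (balanced_pair_iff φ (cycle_neighbours_ne i x)
          (gadgetGraph_adj_cycle_iff (by simpa using hx))).2 (hcycle i x)
    · by_cases hl : l = 2
      · subst hl
        exact (balanced_pair_iff φ (apex_neighbours_ne j) gadgetGraph_adj_apex_iff).2 (hapex j)
      · exact (hclause j l hl).2 (hbal j)

theorem ncard_neighborSet_port (i : Fin n) (t : Fin 4) :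
    ((gadgetGraph n k app).neighborSet (Sum.inl (i, portPosition t))).ncard = 4 :=
  ncard_neighborSet_quadruple (port_neighbours_nodup i (app i t) _) gadgetGraph_adj_port_iff

theorem ncard_neighborSet_gadgetGraph {c : Fin k → Finset (Fin n)}
    (hc : ∀ j, (c j).card = 3) (happ_inj : ∀ i, Function.Injective (app i))
    (happ_mem : ∀ (i : Fin n) (j : Fin k), (∃ t, app i t = j) ↔ i ∈ c j)
    (v : (Fin n × Fin 16) ⊕ (Fin k × Fin 3)) :
    ((gadgetGraph n k app).neighborSet v).ncard = 2 ∨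
      ((gadgetGraph n k app).neighborSet v).ncard = 4 := by
  rcases v with ⟨i, x⟩ | ⟨j, l⟩
  · by_cases hx : ∃ t, x = portPosition t
    · obtain ⟨t, rfl⟩ := hx
      exact Or.inr (ncard_neighborSet_port i t)
    · exact Or.inl (ncard_neighborSet_pair (cycle_neighbours_ne i x)
        (gadgetGraph_adj_cycle_iff (by simpa using hx)))
  · by_cases hl : l = 2
    · subst hl
      exact Or.inl (ncard_neighborSet_pair (apex_neighbours_ne j) gadgetGraph_adj_apex_iff)
    · obtain ⟨a, b, d, hab, had, hbd, hj⟩ := Finset.card_eq_three.1 (hc j)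
      obtain ⟨r, hr⟩ := (happ_mem a j).2 (by simp [hj])
      obtain ⟨s, hs⟩ := (happ_mem b j).2 (by simp [hj])
      obtain ⟨t, ht⟩ := (happ_mem d j).2 (by simp [hj])
      exact Or.inr (ncard_neighborSet_quadruple (clause_neighbours_nodup j _ _ _ hab had hbd)
        (gadgetGraph_adj_clause_iff hl happ_inj (fun i => by simp [happ_mem, hj]) hr hs ht))

/-- A monotone 3-clause is NAE-satisfied exactly when one more value can balance its values. -/
theorem naeSat_iff_exists_balancing {s : Finset (Fin n)} (hs : s.card = 3) (β : Fin n → Fin 2) :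
    NAESat s β ↔ ∃ b : Fin 2, b.val + ∑ i ∈ s, (β i).val = 2 := by
  obtain ⟨a, b, d, hab, had, hbd, rfl⟩ := Finset.card_eq_three.1 hs
  rw [Finset.sum_insert (by simp [hab, had]), Finset.sum_pair hbd]
  simp only [NAESat, Finset.mem_insert, Finset.mem_singleton, forall_eq_or_imp, forall_eq]
  generalize β a = x
  generalize β b = y
  generalize β d = z
  revert x y z
  decide

/-- The colours along the 16-cycle of a variable with value `b`. -/
def cycleColor (b : Fin 2) (x : Fin 16) : Fin 2 :=
  if x.val % 4 = 0 then b else if x.val % 4 = 2 then b + 1 else if x.val % 4 = 1 then 0 else 1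

theorem exists_locallyBalancedOpen_gadgetGraph_iff {c : Fin k → Finset (Fin n)}
    (hc : ∀ j, (c j).card = 3) (happ_inj : ∀ i, Function.Injective (app i))
    (happ_mem : ∀ (i : Fin n) (j : Fin k), (∃ t, app i t = j) ↔ i ∈ c j) :
    (∃ φ, LocallyBalancedOpen (gadgetGraph n k app) φ) ↔
      ∃ β : Fin n → Fin 2, ∀ j, NAESat (c j) β := by
  have hsum : ∀ (φ : (Fin n × Fin 16) ⊕ (Fin k × Fin 3) → Fin 2) (β : Fin n → Fin 2),
      (∀ i t, φ (Sum.inl (i, portPosition t)) = β i) → ∀ j,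
      ∑ i ∈ c j, ∑ t with app i t = j, (φ (Sum.inl (i, portPosition t))).val =
        ∑ i ∈ c j, (β i).val := by
    intro φ β h j
    refine Finset.sum_congr rfl fun i hi => ?_
    obtain ⟨t, rfl⟩ := (happ_mem i j).2 hi
    simp [(happ_inj i).eq_iff, h, Finset.filter_eq']
  simp only [locallyBalancedOpen_gadgetGraph_iff hc happ_inj happ_mem]
  constructor
  · rintro ⟨φ, hcycle, -, hbal⟩
    have hport : ∀ i t, φ (Sum.inl (i, portPosition t)) = φ (Sum.inl (i, 0)) := by
      intro i t
      have hflip : ∀ x y z : Fin 2, y ≠ x → z ≠ y → z = x := by decide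
      have h4 := hflip _ _ _ (hcycle i 1) (hcycle i 3)
      have h8 := hflip _ _ _ (hcycle i 5) (hcycle i 7)
      have h12 := hflip _ _ _ (hcycle i 9) (hcycle i 11)
      fin_cases t
      exacts [rfl, h4, h8.trans h4, h12.trans (h8.trans h4)]
    refine ⟨fun i => φ (Sum.inl (i, 0)), fun j => (naeSat_iff_exists_balancing (hc j) _).2 ?_⟩
    exact ⟨_, hsum φ _ hport j ▸ hbal j⟩
  · rintro ⟨β, hβ⟩
    choose w hw using fun j => (naeSat_iff_exists_balancing (hc j) β).1 (hβ j)
    let φ : (Fin n × Fin 16) ⊕ (Fin k × Fin 3) → Fin 2 :=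
      Sum.elim (fun p => cycleColor (β p.1) p.2) (fun q => ![0, 1, w q.1] q.2)
    have hcolor : ∀ b x, cycleColor b (x + 1) ≠ cycleColor b (x - 1) := by decide
    have hport : ∀ b t, cycleColor b (portPosition t) = b := by decide
    refine ⟨φ, fun i x => hcolor _ _, fun j => by simp [φ], fun j => ?_⟩
    rw [hsum φ β fun i t => hport _ _]
    exact hw j

end GadgetGraph

theorem stmt_14 (n k : ℕ) (hn : 1 ≤ n) (hk : 1 ≤ k)
    (c : Fin k → Finset (Fin n))
    (hc : ∀ j, (c j).card = 3)
    (hvar : ∀ i : Fin n, (Finset.univ.filter (fun j => i ∈ c j)).card = 4)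
    (app : Fin n → Fin 4 → Fin k)
    (happ_inj : ∀ i, Function.Injective (app i))
    (happ_mem : ∀ (i : Fin n) (j : Fin k), (∃ t, app i t = j) ↔ i ∈ c j) :
    (∀ v, Even ((gadgetGraph n k app).neighborSet v).ncard) ∧
    (gadgetGraph n k app).Colorable 2 ∧
    (∀ v, ((gadgetGraph n k app).neighborSet v).ncard ≤ 4) ∧
    (∃ v, ((gadgetGraph n k app).neighborSet v).ncard = 4) ∧
    ((∃ φ, LocallyBalancedOpen (gadgetGraph n k app) φ) ↔
      ∃ β : Fin n → Fin 2, ∀ j, NAESat (c j) β) := by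
  refine ⟨fun v => ?_, ⟨gadgetColoring app⟩, fun v => ?_,
    ⟨_, ncard_neighborSet_port ⟨0, hn⟩ 0⟩,
    exists_locallyBalancedOpen_gadgetGraph_iff hc happ_inj happ_mem⟩
  · rcases ncard_neighborSet_gadgetGraph hc happ_inj happ_mem v with h | h <;> rw [h] <;> decide
  · rcases ncard_neighborSet_gadgetGraph hc happ_inj happ_mem v with h | h <;> omega
end
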